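/- arXiv:1911.05982 — 10 statements merged into one kernel-verified Lean document; each statement's English description precedes it below -/
import Mathlib

section
/- The continuous Hahn Morse function V is smooth on ℝⁿ, and it attains a global minimum on ℝⁿ at a unique point (x₁*, …, xₙ*). -/
/-- `g_a(θ) = (1/2)(arctan((θ+Im a)/Re a) + arctan((θ−Im a)/Re a))`. -/
noncomputable def gfun (a : ℂ) (θ : ℝ) : ℝ :=
  (Real.arctan ((θ + a.im) / a.re) + Real.arctan ((θ - a.im) / a.re)) / 2

/-- `G_a(s) = ∫₀ˢ g_a(θ) dθ`. -/
noncomputable def Gfun (a : ℂ) (s : ℝ) : ℝ := ∫ θ in (0:ℝ)..s, gfun a θ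

/-- `F(s) = ∫₀ˢ arctan(θ) dθ`. -/
noncomputable def Ffun (s : ℝ) : ℝ := ∫ θ in (0:ℝ)..s, Real.arctan θ

/-- The continuous Hahn Morse function
`V(x) = Σ_{j<k} F(x_j − x_k) + Σ_j (G_a(x_j) + G_b(x_j) + (π/2)(n+1−2j)x_j)`,
with `j, k` running through `1, …, n` (so a Lean index `j : Fin n` corresponds to `j+1`). -/
noncomputable def V (n : ℕ) (a b : ℂ) (x : Fin n → ℝ) : ℝ :=
  (∑ j : Fin n, ∑ k : Fin n, if j < k then Ffun (x j - x k) else 0)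
  + ∑ j : Fin n, (Gfun a (x j) + Gfun b (x j)
      + (Real.pi / 2) * ((n : ℝ) + 1 - 2 * (((j : ℕ) : ℝ) + 1)) * x j)

/-- Either `a` and `b` are both real, or `b = conj a`. -/
def PairCond (a b : ℂ) : Prop := (a.im = 0 ∧ b.im = 0) ∨ b = (starRingEnd ℂ) a

lemma contDiff_infty_integral {f : ℝ → ℝ} (hf : ContDiff ℝ (⊤ : ℕ∞) f) :
    ContDiff ℝ (⊤ : ℕ∞) (fun s => ∫ θ in (0:ℝ)..s, f θ) := by
  have hd : ∀ s, HasDerivAt (fun s => ∫ θ in (0:ℝ)..s, f θ) (f s) s :=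
    fun s => (hf.continuous.integral_hasStrictDerivAt 0 s).hasDerivAt
  rw [contDiff_infty_iff_deriv]
  refine ⟨fun s => (hd s).differentiableAt, ?_⟩
  rwa [funext fun s => (hd s).deriv]

lemma strictConvexOn_integral {f : ℝ → ℝ} (hf : Continuous f) (hm : StrictMono f) :
    StrictConvexOn ℝ Set.univ (fun s => ∫ θ in (0:ℝ)..s, f θ) := by
  have hd : ∀ s, HasDerivAt (fun s => ∫ θ in (0:ℝ)..s, f θ) (f s) s :=
    fun s => (hf.integral_hasStrictDerivAt 0 s).hasDerivAt
  refine StrictMono.strictConvexOn_univ_of_deriv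
    (continuous_iff_continuousAt.2 fun s => (hd s).continuousAt) ?_
  rwa [funext fun s => (hd s).deriv]

/-- The graph of a primitive of a monotone function lies above its tangent lines. -/
lemma tangent_le_integral {f : ℝ → ℝ} (hf : Continuous f) (hm : Monotone f) (m s : ℝ) :
    (∫ θ in (0:ℝ)..m, f θ) + f m * (s - m) ≤ ∫ θ in (0:ℝ)..s, f θ := by
  have hi : ∀ u v : ℝ, IntervalIntegrable f MeasureTheory.volume u v :=
    fun u v => hf.intervalIntegrable u v
  have hc : ∀ u v : ℝ, IntervalIntegrable (fun _ : ℝ => f m) MeasureTheory.volume u v :=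
    fun u v => continuous_const.intervalIntegrable u v
  have hadd := intervalIntegral.integral_add_adjacent_intervals (hi 0 m) (hi m s)
  have key : f m * (s - m) ≤ ∫ θ in m..s, f θ := by
    rcases le_total m s with h | h
    · have := intervalIntegral.integral_mono_on h (hc m s) (hi m s) fun x hx => hm hx.1
      rw [intervalIntegral.integral_const, smul_eq_mul] at this
      linarith
    · have := intervalIntegral.integral_mono_on h (hi s m) (hc s m) fun x hx => hm hx.2
      rw [intervalIntegral.integral_const, smul_eq_mul] at this
      rw [intervalIntegral.integral_symm]
      linarith
  linarith

/-- A primitive of a monotone function taking values above `c` and below `-c` grows at least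
like `c * |s|`. -/
lemma exists_linear_growth_integral {f : ℝ → ℝ} (hf : Continuous f) (hm : Monotone f)
    {c p q : ℝ} (hp : c ≤ f p) (hq : f q ≤ -c) :
    ∃ C : ℝ, ∀ s, c * |s| - C ≤ ∫ θ in (0:ℝ)..s, f θ := by
  refine ⟨|(∫ θ in (0:ℝ)..p, f θ) - f p * p| + |(∫ θ in (0:ℝ)..q, f θ) - f q * q|,
    fun s => ?_⟩
  have h1 := tangent_le_integral hf hm p s
  have h2 := tangent_le_integral hf hm q s
  have b1 := neg_abs_le ((∫ θ in (0:ℝ)..p, f θ) - f p * p)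
  have b2 := neg_abs_le ((∫ θ in (0:ℝ)..q, f θ) - f q * q)
  have n1 := abs_nonneg ((∫ θ in (0:ℝ)..p, f θ) - f p * p)
  have n2 := abs_nonneg ((∫ θ in (0:ℝ)..q, f θ) - f q * q)
  rcases le_total 0 s with h | h
  · rw [abs_of_nonneg h]
    have := mul_le_mul_of_nonneg_right hp h
    linarith
  · rw [abs_of_nonpos h]
    have := mul_le_mul_of_nonpos_right hq h
    linarith

lemma contDiff_gfun (a : ℂ) : ContDiff ℝ (⊤ : ℕ∞) (gfun a) := by
  have h1 : ContDiff ℝ (⊤ : ℕ∞) fun θ : ℝ => Real.arctan ((θ + a.im) / a.re) :=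
    Real.contDiff_arctan.comp (by fun_prop)
  have h2 : ContDiff ℝ (⊤ : ℕ∞) fun θ : ℝ => Real.arctan ((θ - a.im) / a.re) :=
    Real.contDiff_arctan.comp (by fun_prop)
  exact (h1.add h2).div_const 2

lemma gfun_strictMono {a : ℂ} (ha : 0 < a.re) : StrictMono (gfun a) := by
  intro s t hst
  have h1 : Real.arctan ((s + a.im) / a.re) < Real.arctan ((t + a.im) / a.re) :=
    Real.arctan_strictMono (by gcongr)
  have h2 : Real.arctan ((s - a.im) / a.re) < Real.arctan ((t - a.im) / a.re) :=
    Real.arctan_strictMono (by gcongr)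
  unfold gfun
  linarith

lemma gfun_neg (a : ℂ) (s : ℝ) : gfun a (-s) = -gfun a s := by
  have h1 : (-s + a.im) / a.re = -((s - a.im) / a.re) := by ring
  have h2 : (-s - a.im) / a.re = -((s + a.im) / a.re) := by ring
  simp only [gfun, h1, h2, Real.arctan_neg]
  ring

lemma gfun_one_pos {a : ℂ} (ha : 0 < a.re) : 0 < gfun a 1 := by
  have := gfun_strictMono ha (show (-1 : ℝ) < 1 by norm_num)
  rw [gfun_neg] at this
  linarith

lemma contDiff_Ffun : ContDiff ℝ (⊤ : ℕ∞) Ffun :=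
  contDiff_infty_integral Real.contDiff_arctan

lemma contDiff_Gfun (a : ℂ) : ContDiff ℝ (⊤ : ℕ∞) (Gfun a) :=
  contDiff_infty_integral (contDiff_gfun a)

lemma strictConvexOn_Ffun : StrictConvexOn ℝ Set.univ Ffun :=
  strictConvexOn_integral Real.continuous_arctan Real.arctan_strictMono

lemma strictConvexOn_Gfun {a : ℂ} (ha : 0 < a.re) : StrictConvexOn ℝ Set.univ (Gfun a) :=
  strictConvexOn_integral (contDiff_gfun a).continuous (gfun_strictMono ha)

lemma exists_linear_growth_Ffun {t : ℝ} (h0 : 0 < t) (ht : t < Real.pi / 2) :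
    ∃ C : ℝ, ∀ s, t * |s| - C ≤ Ffun s := by
  have h := Real.arctan_tan (by linarith) ht
  exact exists_linear_growth_integral Real.continuous_arctan Real.arctan_strictMono.monotone
    (p := Real.tan t) (q := -Real.tan t) h.ge (by rw [Real.arctan_neg, h])

lemma exists_linear_growth_Gfun {a : ℂ} (ha : 0 < a.re) :
    ∃ C : ℝ, ∀ s, gfun a 1 * |s| - C ≤ Gfun a s :=
  exists_linear_growth_integral (contDiff_gfun a).continuous (gfun_strictMono ha).monotone
    (p := 1) (q := -1) le_rfl (gfun_neg a 1).le

/-- The linear part of `V` is the sum of `x j - x k` over pairs `j < k`. -/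
lemma sum_linear_eq_sum_pairs {n : ℕ} (x : Fin n → ℝ) :
    ∑ j : Fin n, ((n : ℝ) + 1 - 2 * (((j : ℕ) : ℝ) + 1)) * x j
      = ∑ j : Fin n, ∑ k : Fin n, if j < k then x j - x k else 0 := by
  have hsplit : ∀ j k : Fin n, (if j < k then x j - x k else 0)
      = (if j < k then x j else 0) - (if j < k then x k else 0) := by
    intro j k; split_ifs <;> ring
  have hupper : ∀ j : Fin n, ∑ k : Fin n, (if j < k then x j else 0)
      = ((n : ℝ) - 1 - (j : ℕ)) * x j := by
    intro j
    rw [← Finset.sum_filter, Finset.sum_const, Finset.filter_lt_eq_Ioi, Fin.card_Ioi,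
      nsmul_eq_mul, Nat.cast_sub (Nat.le_sub_one_of_lt j.isLt), Nat.cast_sub j.pos]
    simp
  have hlower : ∀ k : Fin n, ∑ j : Fin n, (if j < k then x k else 0)
      = ((k : ℕ) : ℝ) * x k := by
    intro k
    rw [← Finset.sum_filter, Finset.sum_const, Finset.filter_gt_eq_Iio, Fin.card_Iio,
      nsmul_eq_mul]
  simp only [hsplit, Finset.sum_sub_distrib, hupper]
  rw [Finset.sum_comm (f := fun j k : Fin n => if j < k then x k else 0)]
  simp only [hlower, ← Finset.sum_sub_distrib]
  exact Finset.sum_congr rfl fun j _ => by ring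

lemma V_eq_sum_pairs (n : ℕ) (a b : ℂ) (x : Fin n → ℝ) :
    V n a b x =
      (∑ j : Fin n, ∑ k : Fin n,
        if j < k then Ffun (x j - x k) + Real.pi / 2 * (x j - x k) else 0)
      + ∑ j : Fin n, (Gfun a (x j) + Gfun b (x j)) := by
  have hsplit : ∀ j k : Fin n,
      (if j < k then Ffun (x j - x k) + Real.pi / 2 * (x j - x k) else 0)
      = (if j < k then Ffun (x j - x k) else 0)
        + Real.pi / 2 * (if j < k then x j - x k else 0) := by
    intro j k; split_ifs <;> ring
  simp only [V, hsplit, Finset.sum_add_distrib, ← Finset.mul_sum, ← sum_linear_eq_sum_pairs,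
    mul_assoc]
  ring

lemma contDiff_V (n : ℕ) (a b : ℂ) : ContDiff ℝ (⊤ : ℕ∞) (V n a b) := by
  have hF := contDiff_Ffun
  have hA := contDiff_Gfun a
  have hB := contDiff_Gfun b
  unfold V
  refine ContDiff.add (ContDiff.sum fun j _ => ContDiff.sum fun k _ => ?_)
    (ContDiff.sum fun j _ => ?_)
  · split_ifs
    · exact hF.comp (by fun_prop)
    · exact contDiff_const
  · exact ((hA.comp (by fun_prop)).add (hB.comp (by fun_prop))).add (by fun_prop)

lemma strictConvexOn_V (n : ℕ) {a b : ℂ} (ha : 0 < a.re) (hb : 0 < b.re) :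
    StrictConvexOn ℝ Set.univ (V n a b) := by
  refine ⟨convex_univ, fun x _ y _ hxy p q hp hq hpq => ?_⟩
  obtain ⟨i, hi⟩ := Function.ne_iff.1 hxy
  have hG : ∀ j, Gfun a (p * x j + q * y j) + Gfun b (p * x j + q * y j)
      ≤ p * (Gfun a (x j) + Gfun b (x j)) + q * (Gfun a (y j) + Gfun b (y j)) := by
    intro j
    have h1 := (strictConvexOn_Gfun ha).convexOn.2 (Set.mem_univ (x j)) (Set.mem_univ (y j))
      hp.le hq.le hpq
    have h2 := (strictConvexOn_Gfun hb).convexOn.2 (Set.mem_univ (x j)) (Set.mem_univ (y j))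
      hp.le hq.le hpq
    simp only [smul_eq_mul] at h1 h2
    linarith
  have hGi : Gfun a (p * x i + q * y i) + Gfun b (p * x i + q * y i)
      < p * (Gfun a (x i) + Gfun b (x i)) + q * (Gfun a (y i) + Gfun b (y i)) := by
    have h1 := (strictConvexOn_Gfun ha).2 (Set.mem_univ (x i)) (Set.mem_univ (y i)) hi hp hq hpq
    have h2 := (strictConvexOn_Gfun hb).2 (Set.mem_univ (x i)) (Set.mem_univ (y i)) hi hp hq hpq
    simp only [smul_eq_mul] at h1 h2
    linarith
  have hF : ∀ j k : Fin n, (if j < k then Ffun (p * x j + q * y j - (p * x k + q * y k))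
        + Real.pi / 2 * (p * x j + q * y j - (p * x k + q * y k)) else 0)
      ≤ p * (if j < k then Ffun (x j - x k) + Real.pi / 2 * (x j - x k) else 0)
        + q * (if j < k then Ffun (y j - y k) + Real.pi / 2 * (y j - y k) else 0) := by
    intro j k
    split_ifs
    · have h := strictConvexOn_Ffun.convexOn.2 (Set.mem_univ (x j - x k))
        (Set.mem_univ (y j - y k)) hp.le hq.le hpq
      simp only [smul_eq_mul] at h
      rw [show p * x j + q * y j - (p * x k + q * y k)
        = p * (x j - x k) + q * (y j - y k) by ring]
      linarith
    · simp
  simp only [V_eq_sum_pairs, Pi.add_apply, Pi.smul_apply, smul_eq_mul]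
  have s1 := Finset.sum_le_sum fun j (_ : j ∈ Finset.univ) =>
    Finset.sum_le_sum fun k (_ : k ∈ Finset.univ) => hF j k
  have s2 := Finset.sum_lt_sum (fun j (_ : j ∈ Finset.univ) => hG j) ⟨i, Finset.mem_univ i, hGi⟩
  simp only [Finset.sum_add_distrib, ← Finset.mul_sum] at s1 s2 ⊢
  linarith

lemma exists_linear_growth_V {n : ℕ} (hn : 1 ≤ n) {a b : ℂ} (ha : 0 < a.re) (hb : 0 < b.re) :
    ∃ c > 0, ∃ C : ℝ, ∀ x : Fin n → ℝ, c * ‖x‖ - C ≤ V n a b x := by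
  have hn' : (0 : ℝ) < n := by exact_mod_cast hn
  obtain ⟨A, hA⟩ := exists_linear_growth_Gfun ha
  obtain ⟨B, hB⟩ := exists_linear_growth_Gfun hb
  have pa := gfun_one_pos ha
  have pb := gfun_one_pos hb
  obtain ⟨ε, hε0, hε1, hε2⟩ : ∃ ε : ℝ, 0 < ε ∧ ε < Real.pi / 2 ∧ ε * (2 * n) ≤ gfun a 1 := by
    refine ⟨min (Real.pi / 4) (gfun a 1 / (2 * n)), ?_, ?_, ?_⟩
    · have := Real.pi_pos
      positivity
    · exact (min_le_left _ _).trans_lt (by linarith [Real.pi_pos])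
    · exact (le_div_iff₀ (by positivity)).1 (min_le_right _ _)
  obtain ⟨D, hD⟩ := exists_linear_growth_Ffun (t := Real.pi / 2 - ε) (by linarith) (by linarith)
  refine ⟨gfun b 1, pb, n * (n * |D|) + n * (A + B), fun x => ?_⟩
  have hpair : ∀ j k : Fin n, -(ε * |x j|) - ε * |x k| - |D| ≤
      if j < k then Ffun (x j - x k) + Real.pi / 2 * (x j - x k) else 0 := by
    intro j k
    have hj := mul_nonneg hε0.le (abs_nonneg (x j))
    have hk := mul_nonneg hε0.le (abs_nonneg (x k))
    split_ifs
    · have h1 := hD (x j - x k)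
      have h2 := mul_le_mul_of_nonneg_left (abs_sub (x j) (x k)) hε0.le
      have h3 := mul_le_mul_of_nonneg_left (neg_abs_le (x j - x k)) Real.pi_div_two_pos.le
      have h4 := le_abs_self D
      linarith
    · linarith [abs_nonneg D]
  have s1 := Finset.sum_le_sum fun j (_ : j ∈ Finset.univ) =>
    Finset.sum_le_sum fun k (_ : k ∈ Finset.univ) => hpair j k
  have s2 := Finset.sum_le_sum fun j (_ : j ∈ Finset.univ) => add_le_add (hA (x j)) (hB (x j))
  have hnorm : ‖x‖ ≤ ∑ j, |x j| := by
    refine (pi_norm_le_iff_of_nonneg (Finset.sum_nonneg fun j _ => abs_nonneg _)).2 fun j => ?_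
    exact Finset.single_le_sum (f := fun j => |x j|) (fun j _ => abs_nonneg _) (Finset.mem_univ j)
  have hS : 0 ≤ ∑ j, |x j| := Finset.sum_nonneg fun j _ => abs_nonneg _
  rw [V_eq_sum_pairs]
  simp only [Finset.sum_add_distrib, Finset.sum_sub_distrib, Finset.sum_neg_distrib,
    ← Finset.mul_sum, Finset.sum_const, Finset.card_univ, Fintype.card_fin, nsmul_eq_mul] at s1 s2 ⊢
  have h1 := mul_le_mul_of_nonneg_left hnorm pb.le
  have h2 := mul_le_mul_of_nonneg_right hε2 hS
  linarith

/-- the continuous Hahn Morse function `V` is smooth on `ℝⁿ` and attains a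
global minimum on `ℝⁿ` at a unique point. -/
theorem continuousHahn_morse_smooth_and_unique_min
    (n : ℕ) (hn : 1 ≤ n) (a b : ℂ) (ha : 0 < a.re) (hb : 0 < b.re) (hab : PairCond a b) :
    ContDiff ℝ (⊤ : ℕ∞) (V n a b) ∧
    ∃! xs : Fin n → ℝ, ∀ y : Fin n → ℝ, V n a b xs ≤ V n a b y := by
  have hV := contDiff_V n a b
  refine ⟨hV, ?_⟩
  obtain ⟨c, hc, C, hC⟩ := exists_linear_growth_V hn ha hb
  have hlim : Filter.Tendsto (V n a b) (Filter.cocompact _) Filter.atTop :=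
    Filter.tendsto_atTop_mono hC <| Filter.tendsto_atTop_add_const_right _ (-C) <|
      (tendsto_norm_cocompact_atTop (E := Fin n → ℝ)).const_mul_atTop hc
  obtain ⟨xs, hxs⟩ := hV.continuous.exists_forall_le hlim
  exact ⟨xs, hxs, fun y hy => (strictConvexOn_V n ha hb).eq_of_isMinOn
    (fun z _ => hy z) (fun z _ => hxs z) (Set.mem_univ y) (Set.mem_univ xs)⟩
end

section
/- The continuous Hahn Morse function V is strictly convex on ℝⁿ: its Hessian H_{jk}(x) = ∂²V/∂x_j∂x_k satisfies, for every x ∈ ℝⁿ and every y ∈ ℝⁿ with y ≠ 0, Σ_{1≤j,k≤n} y_j y_k H_{jk}(x) = Σ_{1≤j≤n} (Re(a/(a² + x_j²)) + Re(b/(b² + x_j²))) y_j² + Σ_{1≤j<k≤n} (y_j − y_k)²/(1 + (x_j − x_k)²) > 0. -/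
/-- Second partial derivative `∂²f/∂x_j∂x_k` of `f : ℝⁿ → ℝ` at `x`. -/
noncomputable def Hess (n : ℕ) (f : (Fin n → ℝ) → ℝ) (x : Fin n → ℝ) (j k : Fin n) : ℝ :=
  fderiv ℝ (fun z => fderiv ℝ f z (Pi.single k 1)) x (Pi.single j 1)

lemma div_sq_add_sq_re (a : ℂ) (ha : 0 < a.re) (t : ℝ) :
    (a / (a ^ 2 + (t : ℂ) ^ 2)).re
      = (a.re / (a.re ^ 2 + (t + a.im) ^ 2) + a.re / (a.re ^ 2 + (t - a.im) ^ 2)) / 2 := by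
  have h1 : a + t * Complex.I ≠ 0 := fun h => by
    have := congrArg Complex.re h
    simp at this
    exact ha.ne' this
  have h2 : a - t * Complex.I ≠ 0 := fun h => by
    have := congrArg Complex.re h
    simp at this
    exact ha.ne' this
  have hprod : a ^ 2 + (t : ℂ) ^ 2 = (a + t * Complex.I) * (a - t * Complex.I) := by
    linear_combination ((t : ℂ) ^ 2) * Complex.I_sq
  have hsplit : a / (a ^ 2 + (t : ℂ) ^ 2)
      = ((a + t * Complex.I)⁻¹ + (a - t * Complex.I)⁻¹) / (2 : ℝ) := by
    rw [hprod]
    field_simp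
    push_cast
    ring
  rw [hsplit, Complex.div_ofReal_re, Complex.add_re, Complex.inv_re, Complex.inv_re]
  simp only [Complex.normSq_apply, Complex.add_re, Complex.add_im, Complex.sub_re, Complex.sub_im,
    Complex.re_ofReal_mul, Complex.im_ofReal_mul, Complex.I_re, Complex.I_im]
  ring_nf

lemma div_sq_add_sq_re_pos (a : ℂ) (ha : 0 < a.re) (t : ℝ) :
    0 < (a / (a ^ 2 + (t : ℂ) ^ 2)).re := by
  rw [div_sq_add_sq_re a ha]
  positivity

lemma hasDerivAt_gfun (a : ℂ) (ha : 0 < a.re) (t : ℝ) :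
    HasDerivAt (gfun a) (a / (a ^ 2 + (t : ℂ) ^ 2)).re t := by
  have h1 := (((hasDerivAt_id t).add_const a.im).div_const a.re).arctan
  have h2 := (((hasDerivAt_id t).sub_const a.im).div_const a.re).arctan
  refine ((h1.add h2).div_const 2).congr_deriv ?_
  rw [div_sq_add_sq_re a ha]
  have := ha.ne'
  simp only [id]
  field_simp

lemma hasDerivAt_Gfun (a : ℂ) (ha : 0 < a.re) (t : ℝ) : HasDerivAt (Gfun a) (gfun a t) t := by
  have hc : Continuous (gfun a) :=
    continuous_iff_continuousAt.2 fun s => (hasDerivAt_gfun a ha s).continuousAt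
  exact hc.integral_hasStrictDerivAt 0 t |>.hasDerivAt

lemma hasDerivAt_Ffun (t : ℝ) : HasDerivAt Ffun (Real.arctan t) t :=
  Real.continuous_arctan.integral_hasStrictDerivAt 0 t |>.hasDerivAt

/-- Differential of a sum of pair interactions and one-body potentials, from the values
`p j k` and `q j` of their derivatives. -/
noncomputable def pairFDeriv {n : ℕ} (p : Fin n → Fin n → ℝ) (q : Fin n → ℝ) :
    (Fin n → ℝ) →L[ℝ] ℝ :=
  (∑ j : Fin n, ∑ k : Fin n, if j < k then
      p j k • (ContinuousLinearMap.proj (R := ℝ) (φ := fun _ : Fin n => ℝ) j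
        - ContinuousLinearMap.proj k) else 0)
    + ∑ j : Fin n, q j • ContinuousLinearMap.proj j

lemma pairFDeriv_apply {n : ℕ} (p : Fin n → Fin n → ℝ) (q v : Fin n → ℝ) :
    pairFDeriv p q v
      = (∑ j : Fin n, ∑ k : Fin n, if j < k then p j k * (v j - v k) else 0)
        + ∑ j : Fin n, q j * v j := by
  simp only [pairFDeriv, add_apply, sum_apply, smul_apply,
    ContinuousLinearMap.proj_apply, smul_eq_mul]
  congr 1
  refine Finset.sum_congr rfl fun j _ => Finset.sum_congr rfl fun k _ => ?_
  split_ifs <;> simp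

lemma hasFDerivAt_pair {n : ℕ} {φ φ' : Fin n → Fin n → ℝ → ℝ} {ψ ψ' : Fin n → ℝ → ℝ}
    (hφ : ∀ j k t, HasDerivAt (φ j k) (φ' j k t) t) (hψ : ∀ j t, HasDerivAt (ψ j) (ψ' j t) t)
    (z : Fin n → ℝ) :
    HasFDerivAt (fun z : Fin n → ℝ =>
        (∑ j : Fin n, ∑ k : Fin n, if j < k then φ j k (z j - z k) else 0) + ∑ j, ψ j (z j))
      (pairFDeriv (fun j k => φ' j k (z j - z k)) fun j => ψ' j (z j)) z := by
  refine HasFDerivAt.add (HasFDerivAt.fun_sum fun j _ => HasFDerivAt.fun_sum fun k _ => ?_)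
    (HasFDerivAt.fun_sum fun j _ => ?_)
  · split_ifs
    · exact (hφ j k (z j - z k)).comp_hasFDerivAt z
        ((hasFDerivAt_apply j z).sub (hasFDerivAt_apply k z))
    · exact hasFDerivAt_const 0 z
  · exact (hψ j (z j)).comp_hasFDerivAt z (hasFDerivAt_apply j z)

lemma fderiv_V {n : ℕ} {a b : ℂ} (ha : 0 < a.re) (hb : 0 < b.re) (z v : Fin n → ℝ) :
    fderiv ℝ (V n a b) z v
      = (∑ j : Fin n, ∑ k : Fin n,
          if j < k then Real.arctan (z j - z k) * (v j - v k) else 0)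
        + ∑ j : Fin n, (gfun a (z j) + gfun b (z j)
          + (Real.pi / 2) * ((n : ℝ) + 1 - 2 * (((j : ℕ) : ℝ) + 1))) * v j := by
  have h := hasFDerivAt_pair (φ := fun _ _ => Ffun) (φ' := fun _ _ => Real.arctan)
    (ψ := fun j t => Gfun a t + Gfun b t
      + (Real.pi / 2) * ((n : ℝ) + 1 - 2 * (((j : ℕ) : ℝ) + 1)) * t)
    (ψ' := fun j t => gfun a t + gfun b t
      + (Real.pi / 2) * ((n : ℝ) + 1 - 2 * (((j : ℕ) : ℝ) + 1)))
    (fun _ _ => hasDerivAt_Ffun)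
    (fun j t => ((hasDerivAt_Gfun a ha t).add (hasDerivAt_Gfun b hb t)).add
      (hasDerivAt_const_mul _)) z
  have hV : fderiv ℝ (V n a b) z = _ := HasFDerivAt.fderiv h
  rw [hV, pairFDeriv_apply]

/-- The Hessian bilinear form of `V` at `x`. -/
noncomputable def hessForm {n : ℕ} (a b : ℂ) (x v : Fin n → ℝ) : (Fin n → ℝ) →L[ℝ] ℝ :=
  pairFDeriv (fun j k => (v j - v k) / (1 + (x j - x k) ^ 2))
    fun j => ((a / (a ^ 2 + (x j : ℂ) ^ 2)).re + (b / (b ^ 2 + (x j : ℂ) ^ 2)).re) * v j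

lemma hessForm_comm {n : ℕ} (a b : ℂ) (x v w : Fin n → ℝ) :
    hessForm a b x v w = hessForm a b x w v := by
  simp only [hessForm, pairFDeriv_apply, div_mul_eq_mul_div, mul_right_comm _ (v _),
    mul_comm (v _ - v _)]

lemma fderiv_fderiv_V {n : ℕ} {a b : ℂ} (ha : 0 < a.re) (hb : 0 < b.re) (x v : Fin n → ℝ) :
    fderiv ℝ (fun z => fderiv ℝ (V n a b) z v) x = hessForm a b x v := by
  simp only [fderiv_V ha hb]
  refine (hasFDerivAt_pair (φ := fun j k t => Real.arctan t * (v j - v k))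
    (φ' := fun j k t => (v j - v k) / (1 + t ^ 2))
    (ψ' := fun j t => ((a / (a ^ 2 + (t : ℂ) ^ 2)).re + (b / (b ^ 2 + (t : ℂ) ^ 2)).re) * v j)
    (ψ := fun j t => (gfun a t + gfun b t
      + (Real.pi / 2) * ((n : ℝ) + 1 - 2 * (((j : ℕ) : ℝ) + 1))) * v j)
    (fun j k t => ?_) (fun j t => ?_) x).fderiv
  · exact ((Real.hasDerivAt_arctan t).mul_const _).congr_deriv (one_div_mul_eq_div _ _)
  · exact (((hasDerivAt_gfun a ha t).add (hasDerivAt_gfun b hb t)).add_const _).mul_const _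

lemma sum_mul_apply_single {n : ℕ} (L : (Fin n → ℝ) →L[ℝ] ℝ) (y : Fin n → ℝ) :
    ∑ j, y j * L (Pi.single j 1) = L y := by
  conv_rhs => rw [pi_eq_sum_univ' y]
  simp [map_sum]

lemma sum_mul_Hess_V {n : ℕ} {a b : ℂ} (ha : 0 < a.re) (hb : 0 < b.re) (x y : Fin n → ℝ) :
    ∑ j : Fin n, ∑ k : Fin n, y j * y k * Hess n (V n a b) x j k = hessForm a b x y y := by
  simp only [Hess, fderiv_fderiv_V ha hb, mul_assoc, ← Finset.mul_sum]
  simp only [fun j k => hessForm_comm a b x (Pi.single k 1) (Pi.single j 1), sum_mul_apply_single]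
  simp only [fun j => hessForm_comm a b x (Pi.single j 1) y, sum_mul_apply_single]

/-- the continuous Hahn Morse function `V` is strictly convex: for every `x`
and every `y ≠ 0`, the Hessian quadratic form equals
`Σ_j (Re(a/(a²+x_j²)) + Re(b/(b²+x_j²))) y_j² + Σ_{j<k} (y_j−y_k)²/(1+(x_j−x_k)²)`
and is positive. -/
theorem continuousHahn_morse_strictly_convex
    (n : ℕ) (hn : 1 ≤ n) (a b : ℂ) (ha : 0 < a.re) (hb : 0 < b.re) (hab : PairCond a b)
    (x y : Fin n → ℝ) (hy : y ≠ 0) :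
    (∑ j : Fin n, ∑ k : Fin n, y j * y k * Hess n (V n a b) x j k)
      = (∑ j : Fin n, ((a / (a ^ 2 + (x j : ℂ) ^ 2)).re
            + (b / (b ^ 2 + (x j : ℂ) ^ 2)).re) * (y j) ^ 2)
        + (∑ j : Fin n, ∑ k : Fin n,
            if j < k then (y j - y k) ^ 2 / (1 + (x j - x k) ^ 2) else 0) ∧
    0 < ∑ j : Fin n, ∑ k : Fin n, y j * y k * Hess n (V n a b) x j k := by
  have heq : (∑ j : Fin n, ∑ k : Fin n, y j * y k * Hess n (V n a b) x j k)
      = (∑ j : Fin n, ((a / (a ^ 2 + (x j : ℂ) ^ 2)).re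
            + (b / (b ^ 2 + (x j : ℂ) ^ 2)).re) * (y j) ^ 2)
        + (∑ j : Fin n, ∑ k : Fin n,
            if j < k then (y j - y k) ^ 2 / (1 + (x j - x k) ^ 2) else 0) := by
    rw [sum_mul_Hess_V ha hb, hessForm, pairFDeriv_apply, add_comm]
    simp only [div_mul_eq_mul_div, mul_assoc, ← sq]
  refine ⟨heq, heq ▸ add_pos_of_pos_of_nonneg ?_ ?_⟩
  · have hpos : ∀ j, 0 < (a / (a ^ 2 + (x j : ℂ) ^ 2)).re + (b / (b ^ 2 + (x j : ℂ) ^ 2)).re :=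
      fun j => add_pos (div_sq_add_sq_re_pos a ha _) (div_sq_add_sq_re_pos b hb _)
    obtain ⟨i, hi⟩ := Function.ne_iff.1 hy
    exact Finset.sum_pos' (fun j _ => mul_nonneg (hpos j).le (sq_nonneg _))
      ⟨i, Finset.mem_univ i, mul_pos (hpos i) (sq_pos_of_ne_zero hi)⟩
  · refine Finset.sum_nonneg fun j _ => Finset.sum_nonneg fun k _ => ?_
    split_ifs <;> positivity
end

section
/- The continuous Hahn Morse function V is radially unbounded (coercive): V(x₁,…,xₙ) → +∞ as x₁² + ⋯ + xₙ² → +∞. -/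
open Filter Topology

theorem sum_lt_sub_eq_sum_mul (n : ℕ) (x : Fin n → ℝ) :
    (∑ j : Fin n, ∑ k : Fin n, if j < k then x j - x k else 0)
      = ∑ j : Fin n, ((n : ℝ) + 1 - 2 * (((j : ℕ) : ℝ) + 1)) * x j := by
  have hsplit : (∑ j : Fin n, ∑ k : Fin n, if j < k then x j - x k else 0)
      = (∑ j : Fin n, ∑ k : Fin n, if j < k then x j else 0)
        - ∑ j : Fin n, ∑ k : Fin n, if k < j then x j else 0 := by
    rw [Finset.sum_comm (f := fun j k => if k < j then x j else 0), ← Finset.sum_sub_distrib]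
    refine Finset.sum_congr rfl fun j _ => ?_
    rw [← Finset.sum_sub_distrib]
    refine Finset.sum_congr rfl fun k _ => ?_
    split_ifs <;> simp
  rw [hsplit, ← Finset.sum_sub_distrib]
  refine Finset.sum_congr rfl fun j _ => ?_
  have hgt : (Finset.univ.filter fun k => j < k) = Finset.Ioi j := by ext; simp
  have hlt : (Finset.univ.filter fun k => k < j) = Finset.Iio j := by ext; simp
  have hcard : (((n - 1 - (j : ℕ) : ℕ)) : ℝ) = n - 1 - (j : ℕ) := by
    have := j.isLt
    rw [Nat.cast_sub (by omega), Nat.cast_sub (by omega), Nat.cast_one]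
  rw [← Finset.sum_filter, ← Finset.sum_filter, Finset.sum_const, Finset.sum_const, hgt, hlt,
    Fin.card_Ioi, Fin.card_Iio, nsmul_eq_mul, nsmul_eq_mul, hcard]
  ring

/-- The primitive of a continuous odd function with limit `c` at `+∞` grows at least like
`(c - ε) |s|`. -/
theorem exists_sub_mul_abs_le_integral_of_odd {h : ℝ → ℝ} {c ε : ℝ} (hc : Continuous h)
    (hodd : ∀ t, h (-t) = -h t) (hlim : Tendsto h atTop (𝓝 c)) (hε : 0 < ε) :
    ∃ C : ℝ, ∀ s : ℝ, (c - ε) * |s| - C ≤ ∫ θ in (0 : ℝ)..s, h θ := by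
  obtain ⟨T₀, hT₀⟩ := eventually_atTop.1 (hlim.eventually (lt_mem_nhds (sub_lt_self c hε)))
  set T := max T₀ 0
  have hint : ∀ u v, IntervalIntegrable h MeasureTheory.volume u v := fun u v =>
    hc.intervalIntegrable u v
  have hprim : Continuous fun s => (∫ θ in (0 : ℝ)..s, h θ) - (c - ε) * s :=
    (intervalIntegral.continuous_primitive hint 0).sub (by fun_prop)
  obtain ⟨m, hm⟩ := (isCompact_Icc (a := (0 : ℝ)) (b := T)).bddBelow_image hprim.continuousOn
  have hle : ∀ s ∈ Set.Icc 0 T, m ≤ (∫ θ in (0 : ℝ)..s, h θ) - (c - ε) * s := fun s hs =>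
    hm ⟨s, hs, rfl⟩
  have hnonneg : ∀ s, 0 ≤ s → (c - ε) * s + m ≤ ∫ θ in (0 : ℝ)..s, h θ := by
    intro s hs
    rcases le_total s T with hsT | hTs
    · linarith [hle s ⟨hs, hsT⟩]
    · have htail : ∫ _ in T..s, (c - ε) ≤ ∫ θ in T..s, h θ :=
        intervalIntegral.integral_mono_on hTs (by simp) (hint _ _) fun θ hθ =>
          (hT₀ θ ((le_max_left _ _).trans hθ.1)).le
      rw [intervalIntegral.integral_const, smul_eq_mul] at htail
      rw [← intervalIntegral.integral_add_adjacent_intervals (hint 0 T) (hint T s)]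
      linarith [hle T ⟨le_max_right _ _, le_rfl⟩]
  refine ⟨-m, fun s => ?_⟩
  rcases le_total 0 s with hs | hs
  · rw [abs_of_nonneg hs]
    linarith [hnonneg s hs]
  · have heven : ∫ θ in (0 : ℝ)..(-s), h θ = ∫ θ in (0 : ℝ)..s, h θ := by
      have := intervalIntegral.integral_comp_neg (a := 0) (b := s) h
      simp only [hodd, intervalIntegral.integral_neg, neg_zero] at this
      rw [intervalIntegral.integral_symm (-s) 0]
      linarith
    rw [abs_of_nonpos hs, ← heven]
    linarith [hnonneg (-s) (neg_nonneg.2 hs)]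

theorem exists_sub_mul_abs_le_Ffun {ε : ℝ} (hε : 0 < ε) :
    ∃ C : ℝ, ∀ s : ℝ, (Real.pi / 2 - ε) * |s| - C ≤ Ffun s :=
  exists_sub_mul_abs_le_integral_of_odd Real.continuous_arctan Real.arctan_neg
    (Real.tendsto_arctan_atTop.mono_right nhdsWithin_le_nhds) hε

theorem exists_sub_mul_abs_le_Gfun {a : ℂ} (ha : 0 < a.re) {ε : ℝ} (hε : 0 < ε) :
    ∃ C : ℝ, ∀ s : ℝ, (Real.pi / 2 - ε) * |s| - C ≤ Gfun a s := by
  have hshift : ∀ d : ℝ, Tendsto (fun θ => Real.arctan ((θ + d) / a.re)) atTop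
      (𝓝 (Real.pi / 2)) := fun d =>
    (Real.tendsto_arctan_atTop.mono_right nhdsWithin_le_nhds).comp
      ((tendsto_atTop_add_const_right _ d tendsto_id).atTop_div_const ha)
  refine exists_sub_mul_abs_le_integral_of_odd (h := gfun a) ?_ ?_ ?_ hε
  · unfold gfun
    exact ((Real.continuous_arctan.comp (by fun_prop)).add
      (Real.continuous_arctan.comp (by fun_prop))).div_const 2
  · intro t
    have h₁ : (-t + a.im) / a.re = -((t - a.im) / a.re) := by ring
    have h₂ : (-t - a.im) / a.re = -((t + a.im) / a.re) := by ring
    rw [gfun, gfun, h₁, h₂, Real.arctan_neg, Real.arctan_neg]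
    ring
  · have := ((hshift a.im).add (hshift (-a.im))).div_const 2
    simp only [← sub_eq_add_neg, add_self_div_two] at this
    exact this

theorem exists_sum_abs_sub_le_V (n : ℕ) {a b : ℂ} (ha : 0 < a.re) (hb : 0 < b.re) :
    ∃ C : ℝ, ∀ x : Fin n → ℝ, ∑ j, |x j| - C ≤ V n a b x := by
  obtain ⟨ε, hε, hεn⟩ : ∃ ε : ℝ, 0 < ε ∧ 2 * (n + 1) * ε = 1 :=
    ⟨1 / (2 * (n + 1)), by positivity, by field_simp⟩
  obtain ⟨C, hC⟩ := exists_sub_mul_abs_le_Ffun hε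
  obtain ⟨A, hA⟩ := exists_sub_mul_abs_le_Gfun ha hε
  obtain ⟨B, hB⟩ := exists_sub_mul_abs_le_Gfun hb hε
  have hC0 : 0 ≤ C := by simpa [Ffun] using hC 0
  refine ⟨n * n * C + n * (A + B), fun x => ?_⟩
  have hV : V n a b x
      = (∑ j : Fin n, ∑ k : Fin n,
          if j < k then Ffun (x j - x k) + Real.pi / 2 * (x j - x k) else 0)
        + ∑ j : Fin n, (Gfun a (x j) + Gfun b (x j)) := by
    have hlin : ∑ j : Fin n, Real.pi / 2 * ((n : ℝ) + 1 - 2 * (((j : ℕ) : ℝ) + 1)) * x j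
        = ∑ j : Fin n, ∑ k : Fin n, if j < k then Real.pi / 2 * (x j - x k) else 0 := by
      simp only [mul_assoc, ← Finset.mul_sum, ← mul_ite_zero, ← sum_lt_sub_eq_sum_mul]
    rw [V, Finset.sum_add_distrib, hlin, add_comm (∑ j : Fin n, (Gfun a (x j) + Gfun b (x j))),
      ← add_assoc, ← Finset.sum_add_distrib]
    congr 1
    refine Finset.sum_congr rfl fun j _ => ?_
    rw [← Finset.sum_add_distrib]
    refine Finset.sum_congr rfl fun k _ => ?_
    split_ifs <;> simp
  have hpair : ∀ j k : Fin n, -ε * (|x j| + |x k|) - C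
      ≤ if j < k then Ffun (x j - x k) + Real.pi / 2 * (x j - x k) else 0 := by
    intro j k
    split_ifs
    · have hs : 0 ≤ Real.pi / 2 * (|x j - x k| + (x j - x k)) :=
        mul_nonneg (by positivity) (by linarith [neg_abs_le (x j - x k)])
      have ht := mul_le_mul_of_nonneg_left (abs_sub (x j) (x k)) hε.le
      linarith [hC (x j - x k)]
    · have := mul_nonneg hε.le (add_nonneg (abs_nonneg (x j)) (abs_nonneg (x k)))
      linarith
  have hpairs := Finset.sum_le_sum fun j (_ : j ∈ Finset.univ) =>
    Finset.sum_le_sum fun k (_ : k ∈ Finset.univ) => hpair j k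
  have hsingle := Finset.sum_le_sum fun j (_ : j ∈ Finset.univ) =>
    add_le_add (hA (x j)) (hB (x j))
  simp only [Finset.sum_sub_distrib, Finset.sum_add_distrib, ← Finset.mul_sum, Finset.sum_const,
    Finset.card_univ, Fintype.card_fin, nsmul_eq_mul] at hpairs hsingle
  rw [hV, Finset.sum_add_distrib]
  have hS : 0 ≤ ∑ j, |x j| := Finset.sum_nonneg fun j _ => abs_nonneg _
  have hεS : 2 * (n + 1) * ε * ∑ j, |x j| = ∑ j, |x j| := by rw [hεn, one_mul]
  have hpiS := mul_le_mul_of_nonneg_right Real.two_le_pi hS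
  linarith


/-- the continuous Hahn Morse function `V` is radially unbounded (coercive):
`V(x) → +∞` as `x₁² + ⋯ + xₙ² → +∞`. -/
theorem continuousHahn_morse_radially_unbounded
    (n : ℕ) (hn : 1 ≤ n) (a b : ℂ) (ha : 0 < a.re) (hb : 0 < b.re) (hab : PairCond a b) :
    ∀ M : ℝ, ∃ R : ℝ, ∀ x : Fin n → ℝ, R ≤ ∑ j : Fin n, (x j) ^ 2 → M ≤ V n a b x := by
  intro M
  obtain ⟨C, hC⟩ := exists_sum_abs_sub_le_V n ha hb
  refine ⟨(M + C) ^ 2, fun x hx => ?_⟩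
  have hS : 0 ≤ ∑ j, |x j| := Finset.sum_nonneg fun j _ => abs_nonneg _
  have hsq : ∑ j, x j ^ 2 ≤ (∑ j, |x j|) ^ 2 := by
    simpa only [sq_abs] using
      Finset.sum_sq_le_sq_sum_of_nonneg fun j (_ : j ∈ Finset.univ) => abs_nonneg (x j)
  linarith [hC x, le_of_abs_le (abs_le_of_sq_le_sq (hx.trans hsq) hS)]
end

section
/- If (x₁,…,xₙ) ∈ ℝⁿ is a critical point of the continuous Hahn Morse function V, i.e. g_a(x_j) + g_b(x_j) + Σ_{k≠j} arctan(x_j − x_k) = (π/2)(2j − n − 1) for every j = 1,…,n, then the Bethe-type equations hold: for each j = 1,…,n, ((i·a + x_j)(i·b + x_j))/((i·a − x_j)(i·b − x_j)) · ∏_{k≠j} (i + x_j − x_k)/(i − x_j + x_k) = (−1)^{n+1} (all denominators being nonzero). -/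
/-- `ip - y` does not vanish for real `y` and `p > 0`. -/
lemma Complex.I_mul_ofReal_sub_ofReal_ne_zero {p : ℝ} (hp : 0 < p) (y : ℝ) :
    Complex.I * (p : ℂ) - (y : ℂ) ≠ 0 := by
  intro h
  have := congrArg Complex.im h
  simp at this
  exact hp.ne' this

/-- The Cayley transform of `y / p` as an exponential of an arctangent. -/
lemma Complex.exp_neg_two_mul_arctan_div {p : ℝ} (hp : 0 < p) (y : ℝ) :
    Complex.exp (((-2 * Real.arctan (y / p) : ℝ) : ℂ) * Complex.I)
      = (Complex.I * (p : ℂ) + (y : ℂ)) / (Complex.I * (p : ℂ) - (y : ℂ)) := by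
  set t := Real.arctan (y / p) with ht
  have hc : Real.cos t ≠ 0 := (Real.cos_arctan_pos _).ne'
  have hs : y * Real.cos t = p * Real.sin t := by
    have h : Real.tan t = y / p := Real.tan_arctan _
    rw [Real.tan_eq_sin_div_cos, div_eq_div_iff hc hp.ne'] at h
    linarith
  have hs' : (y : ℂ) * Complex.cos t = p * Complex.sin t := by exact_mod_cast hs
  have hcs : Complex.sin t ^ 2 + Complex.cos t ^ 2 = 1 := Complex.sin_sq_add_cos_sq _
  have hc' : Complex.cos t ≠ 0 := by exact_mod_cast hc
  rw [eq_div_iff (Complex.I_mul_ofReal_sub_ofReal_ne_zero hp y), Complex.exp_mul_I]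
  push_cast
  rw [neg_mul, Complex.cos_neg, Complex.sin_neg, Complex.cos_two_mul, Complex.sin_two_mul]
  apply mul_right_cancel₀ hc'
  linear_combination (-2 * Complex.cos t ^ 2 + 2 * Complex.I * Complex.sin t * Complex.cos t) * hs'
    - 2 * p * Complex.sin t * Complex.cos t ^ 2 * Complex.I_sq
    + 2 * p * Complex.I * Complex.cos t * hcs

/-- The one-particle Bethe factor is the exponential of `-2i (g_a + g_b)`. -/
lemma exp_neg_two_mul_gfun_add_gfun {a b : ℂ} (ha : 0 < a.re) (hb : 0 < b.re)
    (hab : PairCond a b) (y : ℝ) :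
    (Complex.I * a - (y : ℂ)) * (Complex.I * b - (y : ℂ)) ≠ 0 ∧
      Complex.exp (((-2 * (gfun a y + gfun b y) : ℝ) : ℂ) * Complex.I)
        = ((Complex.I * a + (y : ℂ)) * (Complex.I * b + (y : ℂ)))
          / ((Complex.I * a - (y : ℂ)) * (Complex.I * b - (y : ℂ))) := by
  rcases hab with ⟨ha0, hb0⟩ | rfl
  · have hae : a = (a.re : ℂ) := Complex.ext rfl (by simp [ha0])
    have hbe : b = (b.re : ℂ) := Complex.ext rfl (by simp [hb0])
    have hg : -2 * (gfun a y + gfun b y)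
        = -2 * Real.arctan (y / a.re) + -2 * Real.arctan (y / b.re) := by
      simp only [gfun, ha0, hb0, add_zero, sub_zero]
      ring
    rw [hg, Complex.ofReal_add, add_mul, Complex.exp_add,
      Complex.exp_neg_two_mul_arctan_div ha, Complex.exp_neg_two_mul_arctan_div hb,
      div_mul_div_comm, ← hae, ← hbe]
    refine ⟨mul_ne_zero ?_ ?_, rfl⟩
    · rw [hae]; exact Complex.I_mul_ofReal_sub_ofReal_ne_zero ha y
    · rw [hbe]; exact Complex.I_mul_ofReal_sub_ofReal_ne_zero hb y
  · have hIa : Complex.I * a = Complex.I * (a.re : ℂ) - (a.im : ℂ) := by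
      apply Complex.ext <;> simp
    have hIb : Complex.I * (starRingEnd ℂ) a = Complex.I * (a.re : ℂ) + (a.im : ℂ) := by
      apply Complex.ext <;> simp
    have hg : -2 * (gfun a y + gfun ((starRingEnd ℂ) a) y)
        = -2 * Real.arctan ((y + a.im) / a.re) + -2 * Real.arctan ((y - a.im) / a.re) := by
      simp only [gfun, Complex.conj_re, Complex.conj_im, sub_neg_eq_add, ← sub_eq_add_neg]
      ring
    have hden : (Complex.I * a - (y : ℂ)) * (Complex.I * (starRingEnd ℂ) a - (y : ℂ))
        = (Complex.I * (a.re : ℂ) - ((y + a.im : ℝ) : ℂ))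
          * (Complex.I * (a.re : ℂ) - ((y - a.im : ℝ) : ℂ)) := by
      rw [hIa, hIb]; push_cast; ring
    have hnum : (Complex.I * a + (y : ℂ)) * (Complex.I * (starRingEnd ℂ) a + (y : ℂ))
        = (Complex.I * (a.re : ℂ) + ((y + a.im : ℝ) : ℂ))
          * (Complex.I * (a.re : ℂ) + ((y - a.im : ℝ) : ℂ)) := by
      rw [hIa, hIb]; push_cast; ring
    rw [hg, Complex.ofReal_add, add_mul, Complex.exp_add,
      Complex.exp_neg_two_mul_arctan_div ha, Complex.exp_neg_two_mul_arctan_div ha,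
      div_mul_div_comm, hden, hnum]
    exact ⟨mul_ne_zero (Complex.I_mul_ofReal_sub_ofReal_ne_zero ha _)
      (Complex.I_mul_ofReal_sub_ofReal_ne_zero ha _), rfl⟩

open Complex in
/-- at a critical point of the continuous Hahn Morse function `V` the
Bethe-type equations hold: for each `j`,
`((ia + x_j)(ib + x_j))/((ia − x_j)(ib − x_j)) · ∏_{k≠j} (i + x_j − x_k)/(i − x_j + x_k)
  = (−1)^{n+1}`, all denominators being nonzero. -/
theorem continuousHahn_critical_point_bethe
    (n : ℕ) (hn : 1 ≤ n) (a b : ℂ) (ha : 0 < a.re) (hb : 0 < b.re) (hab : PairCond a b)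
    (x : Fin n → ℝ)
    (hcrit : ∀ j : Fin n,
      gfun a (x j) + gfun b (x j)
        + ∑ k ∈ Finset.univ.erase j, Real.arctan (x j - x k)
      = (Real.pi / 2) * (2 * (((j : ℕ) : ℝ) + 1) - (n : ℝ) - 1)) :
    ∀ j : Fin n,
      (I * a - (x j : ℂ)) * (I * b - (x j : ℂ)) ≠ 0 ∧
      (∀ k : Fin n, k ≠ j → I - (x j : ℂ) + (x k : ℂ) ≠ 0) ∧
      ((I * a + (x j : ℂ)) * (I * b + (x j : ℂ)))
          / ((I * a - (x j : ℂ)) * (I * b - (x j : ℂ)))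
        * ∏ k ∈ Finset.univ.erase j,
            (I + (x j : ℂ) - (x k : ℂ)) / (I - (x j : ℂ) + (x k : ℂ))
      = (-1 : ℂ) ^ (n + 1) := by
  intro j
  obtain ⟨hne, hexp⟩ := exp_neg_two_mul_gfun_add_gfun ha hb hab (x j)
  refine ⟨hne, fun k _ => ?_, ?_⟩
  · have h := I_mul_ofReal_sub_ofReal_ne_zero one_pos (x j - x k)
    push_cast at h
    rwa [mul_one, sub_sub_eq_add_sub, add_sub_right_comm] at h
  have hprod : ∀ k : Fin n, (I + (x j : ℂ) - (x k : ℂ)) / (I - (x j : ℂ) + (x k : ℂ))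
      = exp (((-2 * Real.arctan (x j - x k) : ℝ) : ℂ) * I) := by
    intro k
    have h := exp_neg_two_mul_arctan_div one_pos (x j - x k)
    rw [div_one] at h
    rw [h]
    push_cast
    congr 1 <;> ring
  have hphase : -2 * (gfun a (x j) + gfun b (x j))
      + ∑ k ∈ Finset.univ.erase j, -2 * Real.arctan (x j - x k)
      = Real.pi * ((n : ℝ) + 1) - 2 * Real.pi * (((j : ℕ) : ℝ) + 1) := by
    rw [← Finset.mul_sum, ← mul_add, hcrit j]
    ring
  rw [← hexp, Finset.prod_congr rfl fun k _ => hprod k, ← exp_sum, ← Finset.sum_mul, ← exp_add,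
    ← add_mul, ← ofReal_sum, ← ofReal_add, hphase]
  have hsplit : ((Real.pi * ((n : ℝ) + 1) - 2 * Real.pi * (((j : ℕ) : ℝ) + 1) : ℝ) : ℂ) * I
      = ((n + 1 : ℕ) : ℂ) * (Real.pi * I) - ((j + 1 : ℕ) : ℂ) * (2 * Real.pi * I) := by
    push_cast
    ring
  rw [hsplit, exp_sub, exp_nat_mul, exp_nat_mul_two_pi_mul_I, exp_pi_mul_I, div_one]
end

section
/- Let n ≥ 1 and a, b ∈ ℂ, and let p ∈ ℂ[x] be any monic polynomial of degree n. Then the polynomial q(x) = (x + i·a)(x + i·b)(p(x + i) − p(x)) + (i·a − x)(i·b − x)(p(x − i) − p(x)) has degree at most n, and its coefficient of xⁿ equals −n(n + 2a + 2b − 1). -/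
open Polynomial Complex

/-- The polynomial
`q(x) = (x + ia)(x + ib)(p(x+i) − p(x)) + (ia − x)(ib − x)(p(x−i) − p(x))` in `ℂ[x]`. -/
noncomputable def qpoly (a b : ℂ) (p : Polynomial ℂ) : Polynomial ℂ :=
  (X + C (I * a)) * (X + C (I * b)) * (p.comp (X + C I) - p)
    + (C (I * a) - X) * (C (I * b) - X) * (p.comp (X - C I) - p)

/-- The coefficient of `x ^ m` in `p(x + r)`, for `p` of degree at most `m + 2`. -/
theorem coeff_comp_X_add_C_of_natDegree_le (p : Polynomial ℂ) (r : ℂ) (m : ℕ)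
    (hp : p.natDegree ≤ m + 2) :
    (p.comp (X + C r)).coeff m =
      p.coeff m + (m + 1) * r * p.coeff (m + 1)
        + (m + 2) * (m + 1) / 2 * r ^ 2 * p.coeff (m + 2) := by
  have hd : (hasseDeriv m p).natDegree < 3 := by
    have := natDegree_hasseDeriv_le p m
    omega
  have h2 : ((m + 2).choose m : ℂ) = (m + 2) * (m + 1) / 2 := by
    rw [Nat.choose_symm_add, Nat.cast_choose_two]
    push_cast
    ring
  rw [← taylor_apply, taylor_coeff, eval_eq_sum_range' hd]
  simp only [Finset.sum_range_succ, Finset.sum_range_zero, hasseDeriv_coeff]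
  rw [zero_add m, add_comm 1 m, add_comm 2 m, h2, Nat.choose_self, Nat.choose_succ_self_right]
  push_cast
  ring

theorem qpoly_eq (a b : ℂ) (p : Polynomial ℂ) :
    qpoly a b p =
      (p.comp (X + C I) + p.comp (X + C (-I)) - 2 * p) * X ^ 2
        + C (I * (a + b)) * ((p.comp (X + C I) - p.comp (X + C (-I))) * X)
        - C (a * b) * (p.comp (X + C I) + p.comp (X + C (-I)) - 2 * p) := by
  have hI : (C I : Polynomial ℂ) ^ 2 = -1 := by
    rw [← C_pow, I_sq, C_neg, C_1]
  simp only [qpoly, C_mul, C_add, C_neg, ← sub_eq_add_neg]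
  linear_combination
    C a * C b * (p.comp (X + C I) + p.comp (X - C I) - 2 * p) * hI

/-- The operator `qpoly a b` acts triangularly on coefficients. -/
theorem coeff_qpoly_of_natDegree_le (a b : ℂ) (p : Polynomial ℂ) (m : ℕ)
    (hp : p.natDegree ≤ m) :
    (qpoly a b p).coeff m = -(m : ℂ) * (m + 2 * a + 2 * b - 1) * p.coeff m := by
  have hI : I ^ 2 = -1 := I_sq
  have hz (k : ℕ) (hk : m < k) : p.coeff k = 0 := coeff_eq_zero_of_natDegree_lt (by omega)
  have h2 (k : ℕ) : (2 * p).coeff k = 2 * p.coeff k := by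
    simp
  rw [qpoly_eq]
  match m with
  | 0 =>
    simp only [coeff_add, coeff_sub, mul_coeff_zero, coeff_X_zero, coeff_X_pow, h2,
      coeff_comp_X_add_C_of_natDegree_le p _ 0 (by omega), hz (0 + 1) (by omega),
      hz (0 + 2) (by omega)]
    simp
    ring_nf
    simp
  | 1 =>
    rw [coeff_sub, coeff_add, coeff_C_mul, coeff_C_mul, coeff_mul_X, coeff_mul_X_pow']
    simp only [coeff_add, coeff_sub, h2,
      coeff_comp_X_add_C_of_natDegree_le p _ 0 (by omega),
      coeff_comp_X_add_C_of_natDegree_le p _ 1 (by omega), hz (0 + 2) (by omega),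
      hz (1 + 2) (by omega)]
    norm_num
    linear_combination 2 * (a + b) * p.coeff 1 * hI
  | k + 2 =>
    rw [coeff_sub, coeff_add, coeff_C_mul, coeff_C_mul, coeff_mul_X, coeff_mul_X_pow]
    simp only [coeff_add, coeff_sub, h2,
      coeff_comp_X_add_C_of_natDegree_le p _ k (by omega),
      coeff_comp_X_add_C_of_natDegree_le p _ (k + 1) (by omega),
      coeff_comp_X_add_C_of_natDegree_le p _ (k + 2) (by omega), hz (k + 1 + 2) (by omega),
      hz (k + 2 + 2) (by omega)]
    push_cast
    linear_combination
      ((k + 2) * (k + 1) + 2 * (a + b) * (k + 2)) * p.coeff (k + 2) * hI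

/-- for any monic polynomial `p ∈ ℂ[x]` of degree `n ≥ 1`, the polynomial
`q(x) = (x + ia)(x + ib)(p(x+i) − p(x)) + (ia − x)(ib − x)(p(x−i) − p(x))` has degree at
most `n`, and its coefficient of `xⁿ` equals `−n(n + 2a + 2b − 1)`. -/
theorem continuousHahn_difference_operator_degree
    (n : ℕ) (hn : 1 ≤ n) (a b : ℂ) (p : Polynomial ℂ)
    (hmonic : p.Monic) (hdeg : p.natDegree = n) :
    (qpoly a b p).degree ≤ (n : WithBot ℕ) ∧
    (qpoly a b p).coeff n = -(n : ℂ) * ((n : ℂ) + 2 * a + 2 * b - 1) := by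
  refine ⟨(degree_le_iff_coeff_zero _ _).2 fun m hm => ?_, ?_⟩
  · have hm : n < m := by exact_mod_cast hm
    rw [coeff_qpoly_of_natDegree_le a b p m (by omega),
      coeff_eq_zero_of_natDegree_lt (by omega), mul_zero]
  · have hlead : p.coeff n = 1 := hdeg ▸ hmonic
    rw [coeff_qpoly_of_natDegree_le a b p n hdeg.le, hlead, mul_one]
end

section
/- Let n ≥ 1, let a, b ∈ ℂ with Re(a), Re(b) > 0, let x₁, …, xₙ be pairwise distinct real numbers, and set p(x) = (x − x₁)(x − x₂)⋯(x − xₙ) ∈ ℂ[x] and A(x) = (x + i·a)(x + i·b). If A(x_j)·p(x_j + i) + A(−x_j)·p(x_j − i) = 0 for every j = 1,…,n, then p satisfies the continuous Hahn difference equation identically: A(x)(p(x + i) − p(x)) + A(−x)(p(x − i) − p(x)) = −n(n + 2a + 2b − 1)·p(x) for all x ∈ ℂ. -/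
open Polynomial Complex

lemma C_mul_mem_degreeLT {R : Type*} [CommRing R] {k : ℕ} {f : R[X]} (c : R)
    (hf : f ∈ degreeLT R k) : C c * f ∈ degreeLT R k := by
  rw [← smul_eq_C_mul]
  exact Submodule.smul_mem _ c hf

lemma X_mul_mem_degreeLT_succ {R : Type*} [CommRing R] {k : ℕ} {f : R[X]}
    (hf : f ∈ degreeLT R k) : X * f ∈ degreeLT R (k + 1) := by
  rw [mem_degreeLT, degree_lt_iff_coeff_zero] at *
  rintro (_ | m) hm
  · omega
  · rw [coeff_X_mul]
    exact hf m (by omega)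

lemma X_sub_C_mul_mem_degreeLT_succ {R : Type*} [CommRing R] {k : ℕ} {f : R[X]} (c : R)
    (hf : f ∈ degreeLT R k) : (X - C c) * f ∈ degreeLT R (k + 1) := by
  rw [sub_mul]
  exact sub_mem (X_mul_mem_degreeLT_succ hf)
    (degreeLT_mono k.le_succ (C_mul_mem_degreeLT c hf))

/-- The leading behaviour of the first and second central differences, with step `r` satisfying
`r * r = -1`, of a product of `k` monic linear factors. -/
lemma central_differences_mem_degreeLT {R ι : Type*} [CommRing R] {r : R} (hr : r * r = -1)
    (s : Finset ι) (x : ι → R) (q D S : R[X]) (hq : q = ∏ j ∈ s, (X - C (x j)))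
    (hD : D = q.comp (X + C r) - q.comp (X - C r))
    (hS : S = q.comp (X + C r) + q.comp (X - C r) - 2 * q) :
    q ∈ degreeLT R (s.card + 1) ∧ D ∈ degreeLT R s.card ∧ S ∈ degreeLT R s.card ∧
      X * D - C (2 * r * s.card) * q ∈ degreeLT R s.card ∧
      X ^ 2 * S + C (s.card * (s.card - 1) : R) * q ∈ degreeLT R s.card := by
  classical
  induction s using Finset.induction_on generalizing q D S with
  | empty =>
    have hD0 : D = 0 := by simp [hD, hq]
    have hS0 : S = 0 := by simp [hS, hq]; norm_num
    have hq1 : q = 1 := by simp [hq]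
    simp only [hD0, hS0, hq1]
    refine ⟨?_, by simp, by simp, by simp, by simp⟩
    rw [mem_degreeLT]
    exact degree_one_le.trans_lt (by simp)
  | insert j s hj ih =>
    obtain ⟨q₀, hq₀⟩ : ∃ q₀, q₀ = ∏ j ∈ s, (X - C (x j)) := ⟨_, rfl⟩
    obtain ⟨D₀, hD₀⟩ : ∃ D₀, D₀ = q₀.comp (X + C r) - q₀.comp (X - C r) := ⟨_, rfl⟩
    obtain ⟨S₀, hS₀⟩ : ∃ S₀, S₀ = q₀.comp (X + C r) + q₀.comp (X - C r) - 2 * q₀ := ⟨_, rfl⟩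
    obtain ⟨h1, h2, h3, h4, h5⟩ := ih q₀ D₀ S₀ hq₀ hD₀ hS₀
    have hq' : q = (X - C (x j)) * q₀ := by rw [hq, Finset.prod_insert hj, hq₀]
    have hD' : D = (X - C (x j)) * D₀ + C r * S₀ + C (2 * r) * q₀ := by
      simp only [hD, hq', hD₀, hS₀, mul_comp, sub_comp, X_comp, C_comp, map_mul, map_ofNat]
      ring
    have hS' : S = (X - C (x j)) * S₀ + C r * D₀ := by
      simp only [hS, hq', hD₀, hS₀, mul_comp, sub_comp, X_comp, C_comp]
      ring
    have hrC : (C r : R[X]) * C r = -1 := by rw [← C_mul, hr]; simp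
    rw [Finset.card_insert_of_notMem hj]
    generalize s.card = k at *
    refine ⟨?_, ?_, ?_, ?_, ?_⟩
    · rw [hq']
      exact X_sub_C_mul_mem_degreeLT_succ _ h1
    · rw [hD']
      exact add_mem (add_mem (X_sub_C_mul_mem_degreeLT_succ _ h2)
        (degreeLT_mono k.le_succ (C_mul_mem_degreeLT _ h3))) (C_mul_mem_degreeLT _ h1)
    · rw [hS']
      exact add_mem (X_sub_C_mul_mem_degreeLT_succ _ h3)
        (degreeLT_mono k.le_succ (C_mul_mem_degreeLT _ h2))
    · have : X * D - C (2 * r * ((k + 1 : ℕ) : R)) * q =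
          (X - C (x j)) * (X * D₀ - C (2 * r * k) * q₀) + C r * (X * S₀)
            + C (2 * r * x j) * q₀ := by
        rw [hD', hq']
        simp only [map_mul, map_ofNat, map_natCast]
        push_cast
        ring
      rw [this]
      exact add_mem (add_mem (X_sub_C_mul_mem_degreeLT_succ _ h4)
        (C_mul_mem_degreeLT _ (X_mul_mem_degreeLT_succ h3))) (C_mul_mem_degreeLT _ h1)
    · have : X ^ 2 * S + C (((k + 1 : ℕ) : R) * (((k + 1 : ℕ) : R) - 1)) * q =
          (X - C (x j)) * (X ^ 2 * S₀ + C (k * (k - 1) : R) * q₀)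
            + C r * (X * (X * D₀ - C (2 * r * k) * q₀)) + C (-2 * k * x j) * q₀ := by
        rw [hS', hq']
        simp only [map_mul, map_ofNat, map_natCast, map_sub, map_neg, map_one]
        push_cast
        linear_combination 2 * k * X * q₀ * hrC
      rw [this]
      exact add_mem (add_mem (X_sub_C_mul_mem_degreeLT_succ _ h5)
        (C_mul_mem_degreeLT _ (X_mul_mem_degreeLT_succ h4))) (C_mul_mem_degreeLT _ h1)

/-- let `x₁, …, xₙ` be pairwise distinct reals, `p(x) = ∏ⱼ (x − xⱼ)` and
`A(x) = (x + ia)(x + ib)`. If `A(x_j)p(x_j + i) + A(−x_j)p(x_j − i) = 0` for all `j`,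
then `A(x)(p(x+i) − p(x)) + A(−x)(p(x−i) − p(x)) = −n(n + 2a + 2b − 1)p(x)` for all
`x ∈ ℂ`. -/
theorem continuousHahn_difference_equation
    (n : ℕ) (hn : 1 ≤ n) (a b : ℂ) (ha : 0 < a.re) (hb : 0 < b.re)
    (x : Fin n → ℝ) (hx : Function.Injective x)
    (A : ℂ → ℂ) (hA : A = fun z => (z + I * a) * (z + I * b))
    (p : Polynomial ℂ) (hp : p = ∏ j : Fin n, (X - C (x j : ℂ)))
    (hnodes : ∀ j : Fin n,
      A (x j) * p.eval ((x j : ℂ) + I) + A (-(x j : ℂ)) * p.eval ((x j : ℂ) - I) = 0) :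
    ∀ z : ℂ,
      A z * (p.eval (z + I) - p.eval z) + A (-z) * (p.eval (z - I) - p.eval z)
        = -(n : ℂ) * ((n : ℂ) + 2 * a + 2 * b - 1) * p.eval z := by
  intro z
  obtain ⟨D, hD⟩ : ∃ D, D = p.comp (X + C I) - p.comp (X - C I) := ⟨_, rfl⟩
  obtain ⟨S, hS⟩ : ∃ S, S = p.comp (X + C I) + p.comp (X - C I) - 2 * p := ⟨_, rfl⟩
  obtain ⟨-, -, h3, h4, h5⟩ := central_differences_mem_degreeLT I_mul_I Finset.univ
    (fun j => (x j : ℂ)) p D S hp hD hS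
  simp only [Finset.card_univ, Fintype.card_fin] at h3 h4 h5
  obtain ⟨F, hF⟩ : ∃ F, F = (X ^ 2 * S + C (n * (n - 1) : ℂ) * p)
    + C (I * (a + b)) * (X * D - C (2 * I * n) * p) - C (a * b) * S := ⟨_, rfl⟩
  have hFdeg : F ∈ degreeLT ℂ n := hF ▸
    sub_mem (add_mem h5 (C_mul_mem_degreeLT _ h4)) (C_mul_mem_degreeLT _ h3)
  have hFeval (w : ℂ) : F.eval w =
      A w * (p.eval (w + I) - p.eval w) + A (-w) * (p.eval (w - I) - p.eval w)
        + n * (n + 2 * a + 2 * b - 1) * p.eval w := by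
    simp only [hF, hS, hD, hA, eval_add, eval_sub, eval_mul, eval_comp, eval_X, eval_C, eval_pow,
      eval_ofNat]
    linear_combination (-2 * (a + b) * n * p.eval w
      - a * b * (p.eval (w + I) + p.eval (w - I) - 2 * p.eval w)) * I_mul_I
  have hF0 : F = 0 := by
    refine eq_zero_of_degree_lt_of_eval_index_eq_zero (s := Finset.univ)
      (v := fun j => (x j : ℂ)) ((ofReal_injective.comp hx).injOn) ?_ ?_
    · simpa [mem_degreeLT] using hFdeg
    · intro j _
      have hpj : p.eval (x j : ℂ) = 0 := by
        rw [hp, eval_prod]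
        exact Finset.prod_eq_zero (Finset.mem_univ j) (by simp)
      rw [hFeval, hpj]
      linear_combination hnodes j
  have hz := hFeval z
  rw [hF0, eval_zero] at hz
  linear_combination -hz
end

section
/- Let n ≥ 1, let a, b ∈ ℂ with Re(a), Re(b) > 0 such that either a and b are both real or b = conj(a), and let R > 0. Then for every x ∈ ℝⁿ with |x_j| ≤ R for all j, and for every y ∈ ℝⁿ, Σ_{1≤j≤n} (Re(a/(a² + x_j²)) + Re(b/(b² + x_j²))) y_j² + Σ_{1≤j<k≤n} (y_j − y_k)²/(1 + (x_j − x_k)²) ≥ (Re(a)/(Re(a)² + (R + |Im(a)|)²) + Re(b)/(Re(b)² + (R + |Im(b)|)²))·(y₁² + ⋯ + yₙ²). -/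
theorem Complex.div_sq_add_ofReal_sq_eq {a : ℂ} (ha : 0 < a.re) (x : ℝ) :
    a / (a ^ 2 + (x : ℂ) ^ 2) = ((a + x * Complex.I)⁻¹ + (a - x * Complex.I)⁻¹) / 2 := by
  have hp : a + x * Complex.I ≠ 0 := fun h => ha.ne' (by simpa using congrArg Complex.re h)
  have hm : a - x * Complex.I ≠ 0 := fun h => ha.ne' (by simpa using congrArg Complex.re h)
  have hfac : a ^ 2 + (x : ℂ) ^ 2 = (a + x * Complex.I) * (a - x * Complex.I) := by
    linear_combination (x : ℂ) ^ 2 * Complex.I_sq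
  rw [hfac]
  field_simp
  ring

theorem Complex.le_re_inv_of_abs_im_le {w : ℂ} {r : ℝ} (hw : 0 < w.re) (h : |w.im| ≤ r) :
    w.re / (w.re ^ 2 + r ^ 2) ≤ (w⁻¹).re := by
  have hsq : w.im ^ 2 ≤ r ^ 2 := sq_le_sq' (neg_le_of_abs_le h) (le_of_abs_le h)
  rw [Complex.inv_re, Complex.normSq_apply, ← sq, ← sq]
  gcongr

theorem Complex.le_re_div_sq_add_ofReal_sq {a : ℂ} (ha : 0 < a.re) {R x : ℝ} (hx : |x| ≤ R) :
    a.re / (a.re ^ 2 + (R + |a.im|) ^ 2) ≤ (a / (a ^ 2 + (x : ℂ) ^ 2)).re := by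
  have hp : a.re / (a.re ^ 2 + (R + |a.im|) ^ 2) ≤ ((a + x * Complex.I)⁻¹).re := by
    have hw : (a + x * Complex.I).re = a.re := by simp
    have him : |(a + x * Complex.I).im| ≤ R + |a.im| := by
      have := abs_add_le a.im x
      simp
      linarith
    simpa only [hw] using Complex.le_re_inv_of_abs_im_le (hw ▸ ha) him
  have hm : a.re / (a.re ^ 2 + (R + |a.im|) ^ 2) ≤ ((a - x * Complex.I)⁻¹).re := by
    have hw : (a - x * Complex.I).re = a.re := by simp
    have him : |(a - x * Complex.I).im| ≤ R + |a.im| := by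
      have := abs_sub a.im x
      simp
      linarith
    simpa only [hw] using Complex.le_re_inv_of_abs_im_le (hw ▸ ha) him
  rw [Complex.div_sq_add_ofReal_sq_eq ha, Complex.div_ofNat_re, Complex.add_re]
  linarith

/-- lower bound for the quadratic form of the Hessian of the continuous
Hahn Morse function: for `|x_j| ≤ R` and any `y`,
`Σ_j (Re(a/(a²+x_j²)) + Re(b/(b²+x_j²))) y_j² + Σ_{j<k} (y_j−y_k)²/(1+(x_j−x_k)²)
  ≥ (Re a/(Re²a+(R+|Im a|)²) + Re b/(Re²b+(R+|Im b|)²)) (y₁²+⋯+yₙ²)`. -/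
theorem continuousHahn_hessian_lower_bound
    (n : ℕ) (hn : 1 ≤ n) (a b : ℂ) (ha : 0 < a.re) (hb : 0 < b.re) (hab : PairCond a b)
    (R : ℝ) (hR : 0 < R) (x : Fin n → ℝ) (hx : ∀ j : Fin n, |x j| ≤ R)
    (y : Fin n → ℝ) :
    (a.re / (a.re ^ 2 + (R + |a.im|) ^ 2) + b.re / (b.re ^ 2 + (R + |b.im|) ^ 2))
        * ∑ j : Fin n, (y j) ^ 2
      ≤ (∑ j : Fin n, ((a / (a ^ 2 + (x j : ℂ) ^ 2)).re
            + (b / (b ^ 2 + (x j : ℂ) ^ 2)).re) * (y j) ^ 2)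
        + (∑ j : Fin n, ∑ k : Fin n,
            if j < k then (y j - y k) ^ 2 / (1 + (x j - x k) ^ 2) else 0) := by
  have hdiag : (a.re / (a.re ^ 2 + (R + |a.im|) ^ 2) + b.re / (b.re ^ 2 + (R + |b.im|) ^ 2))
      * ∑ j : Fin n, (y j) ^ 2
      ≤ ∑ j : Fin n, ((a / (a ^ 2 + (x j : ℂ) ^ 2)).re
          + (b / (b ^ 2 + (x j : ℂ) ^ 2)).re) * (y j) ^ 2 := by
    rw [Finset.mul_sum]
    refine Finset.sum_le_sum fun j _ => mul_le_mul_of_nonneg_right ?_ (sq_nonneg _)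
    exact add_le_add (Complex.le_re_div_sq_add_ofReal_sq ha (hx j))
      (Complex.le_re_div_sq_add_ofReal_sq hb (hx j))
  refine hdiag.trans (le_add_of_nonneg_right ?_)
  refine Finset.sum_nonneg fun j _ => Finset.sum_nonneg fun k _ => ?_
  split_ifs <;> positivity
end

section
/- If (x₁,…,xₙ) ∈ ℝⁿ is a critical point of the Wilson Morse function W, i.e. g_a(x_j) + g_b(x_j) + g_c(x_j) + g_d(x_j) + Σ_{k≠j} (arctan(x_j + x_k) + arctan(x_j − x_k)) = π·j for every j = 1,…,n, then 0 < x₁ < x₂ < ⋯ < xₙ and the Bethe-type equations hold: for each j = 1,…,n, ((i·a + x_j)(i·b + x_j)(i·c + x_j)(i·d + x_j))/((i·a − x_j)(i·b − x_j)(i·c − x_j)(i·d − x_j)) · ∏_{k≠j} ((i + x_j + x_k)(i + x_j − x_k))/((i − x_j − x_k)(i − x_j + x_k)) = 1 (all denominators being nonzero). -/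
/-- The Wilson Morse function
`W(x) = Σ_{j<k} (F(x_j + x_k) + F(x_j − x_k))
        + Σ_j (G_a(x_j) + G_b(x_j) + G_c(x_j) + G_d(x_j) − π·j·x_j)`,
with `j, k` running through `1, …, n` (so a Lean index `j : Fin n` corresponds to `j+1`). -/
noncomputable def W (n : ℕ) (a b c d : ℂ) (x : Fin n → ℝ) : ℝ :=
  (∑ j : Fin n, ∑ k : Fin n, if j < k then Ffun (x j + x k) + Ffun (x j - x k) else 0)
  + ∑ j : Fin n, (Gfun a (x j) + Gfun b (x j) + Gfun c (x j) + Gfun d (x j)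
      - Real.pi * (((j : ℕ) : ℝ) + 1) * x j)

/-- Non-real parameters among `{a,b,c,d}` occur in complex-conjugate pairs, i.e. the
multiset `{a,b,c,d}` is invariant under complex conjugation. -/
def QuadCond (a b c d : ℂ) : Prop :=
  Multiset.map (starRingEnd ℂ) {a, b, c, d} = ({a, b, c, d} : Multiset ℂ)

lemma QuadCond.sum_conj {M : Type*} [AddCommMonoid M] {a b c d : ℂ} (h : QuadCond a b c d)
    (f : ℂ → M) :
    f (starRingEnd ℂ a) + f (starRingEnd ℂ b) + f (starRingEnd ℂ c) + f (starRingEnd ℂ d)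
      = f a + f b + f c + f d := by
  have := congrArg (fun s => (Multiset.map f s).sum) h
  simpa [Multiset.insert_eq_cons, add_assoc] using this

lemma QuadCond.prod_conj {M : Type*} [CommMonoid M] {a b c d : ℂ} (h : QuadCond a b c d)
    (f : ℂ → M) :
    f (starRingEnd ℂ a) * f (starRingEnd ℂ b) * f (starRingEnd ℂ c) * f (starRingEnd ℂ d)
      = f a * f b * f c * f d := by
  have := congrArg (fun s => (Multiset.map f s).prod) h
  simpa [Multiset.insert_eq_cons, mul_assoc] using this

lemma gfun_mono {a : ℂ} (ha : 0 < a.re) : Monotone (gfun a) := by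
  intro x y hxy
  unfold gfun
  gcongr

lemma gfun_zero (a : ℂ) : gfun a 0 = 0 := by
  simp [gfun, neg_div, Real.arctan_neg]

lemma I_sub_ofReal_ne_zero (x : ℝ) : Complex.I - (x : ℂ) ≠ 0 := by
  intro h
  simpa using congrArg Complex.im h

lemma I_mul_sub_ofReal_ne_zero {a : ℂ} (ha : 0 < a.re) (x : ℝ) :
    Complex.I * a - (x : ℂ) ≠ 0 := by
  intro h
  have := congrArg Complex.im h
  simp at this
  exact ha.ne' this

lemma exp_neg_two_I_mul_arctan (x : ℝ) :
    Complex.exp (-(2 * Complex.I * (Real.arctan x : ℂ)))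
      = (Complex.I + x) / (Complex.I - x) := by
  have hpos : (0 : ℝ) < 1 + x ^ 2 := by positivity
  have hs : (Real.sqrt (1 + x ^ 2)) ^ 2 = 1 + x ^ 2 := Real.sq_sqrt hpos.le
  have hs0 : (Real.sqrt (1 + x ^ 2)) ≠ 0 := (Real.sqrt_pos.mpr hpos).ne'
  have hexp : Complex.exp (-(2 * Complex.I * (Real.arctan x : ℂ)))
      = (Complex.exp ((-Real.arctan x : ℝ) * Complex.I)) ^ 2 := by
    rw [← Complex.exp_nat_mul]
    congr 1
    push_cast
    ring
  rw [hexp, Complex.exp_mul_I, ← Complex.ofReal_cos, ← Complex.ofReal_sin, Real.cos_neg,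
    Real.sin_neg, Real.cos_arctan, Real.sin_arctan, eq_div_iff (I_sub_ofReal_ne_zero x)]
  have hsC : ((Real.sqrt (1 + x ^ 2) : ℝ) : ℂ) ^ 2 = 1 + (x : ℂ) ^ 2 := by exact_mod_cast hs
  have hs0C : ((Real.sqrt (1 + x ^ 2) : ℝ) : ℂ) ≠ 0 := by exact_mod_cast hs0
  push_cast
  field_simp
  rw [hsC]
  linear_combination (Complex.I * x ^ 2 - 2 * x - x ^ 3) * Complex.I_sq

lemma exp_neg_two_I_mul_arctan_param {a : ℂ} (ha : 0 < a.re) (x : ℝ) :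
    Complex.exp (-(2 * Complex.I * (Real.arctan ((x + a.im) / a.re) : ℂ)))
      = (Complex.I * starRingEnd ℂ a + x) / (Complex.I * a - x) := by
  have h0 : (a.re : ℂ) ≠ 0 := by exact_mod_cast ha.ne'
  rw [exp_neg_two_I_mul_arctan, div_eq_div_iff (I_sub_ofReal_ne_zero _)
    (I_mul_sub_ofReal_ne_zero ha x)]
  have hconj : starRingEnd ℂ a = a.re - a.im * Complex.I := by
    apply Complex.ext <;> simp
  have h : a = a.re + a.im * Complex.I := (Complex.re_add_im a).symm
  rw [hconj]
  generalize a.re = r at *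
  generalize a.im = s at *
  subst h
  push_cast
  field_simp
  linear_combination 2 * Complex.I * r * s * Complex.I_sq

lemma exp_neg_two_I_mul_ofReal_add (u v : ℝ) :
    Complex.exp (-(2 * Complex.I * ((u + v : ℝ) : ℂ)))
      = Complex.exp (-(2 * Complex.I * (u : ℂ))) * Complex.exp (-(2 * Complex.I * (v : ℂ))) := by
  rw [Complex.ofReal_add, mul_add, neg_add, Complex.exp_add]

lemma QuadCond.exp_neg_two_I_mul_gfun {a b c d : ℂ} (h : QuadCond a b c d)
    (ha : 0 < a.re) (hb : 0 < b.re) (hc : 0 < c.re) (hd : 0 < d.re) (x : ℝ) :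
    Complex.exp (-(2 * Complex.I * ((gfun a x + gfun b x + gfun c x + gfun d x : ℝ) : ℂ)))
      = ((Complex.I * a + x) * (Complex.I * b + x) * (Complex.I * c + x) * (Complex.I * d + x))
        / ((Complex.I * a - x) * (Complex.I * b - x) * (Complex.I * c - x)
          * (Complex.I * d - x)) := by
  have hsum := h.sum_conj fun z => Real.arctan ((x + z.im) / z.re)
  have hprod := h.prod_conj fun z => Complex.I * z + (x : ℂ)
  simp only [Complex.conj_im, Complex.conj_re, ← sub_eq_add_neg] at hsum
  have hg : gfun a x + gfun b x + gfun c x + gfun d x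
      = Real.arctan ((x + a.im) / a.re) + Real.arctan ((x + b.im) / b.re)
        + Real.arctan ((x + c.im) / c.re) + Real.arctan ((x + d.im) / d.re) := by
    unfold gfun
    linarith
  rw [hg, ← hprod]
  simp only [exp_neg_two_I_mul_ofReal_add]
  rw [exp_neg_two_I_mul_arctan_param ha, exp_neg_two_I_mul_arctan_param hb,
    exp_neg_two_I_mul_arctan_param hc, exp_neg_two_I_mul_arctan_param hd]
  simp only [div_mul_div_comm]

open Complex in
/-- at a critical point of the Wilson Morse function `W`, i.e. a solution
of `g_a(x_j)+g_b(x_j)+g_c(x_j)+g_d(x_j) + Σ_{k≠j}(arctan(x_j+x_k)+arctan(x_j−x_k)) = πj`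
for `j = 1, …, n`, one has `0 < x₁ < ⋯ < xₙ` and the Bethe-type equations
`((ia+x_j)(ib+x_j)(ic+x_j)(id+x_j))/((ia−x_j)(ib−x_j)(ic−x_j)(id−x_j)) ·
 ∏_{k≠j} ((i+x_j+x_k)(i+x_j−x_k))/((i−x_j−x_k)(i−x_j+x_k)) = 1` hold, all denominators
being nonzero. -/
theorem wilson_critical_point_positive_strictMono_bethe
    (n : ℕ) (hn : 1 ≤ n) (a b c d : ℂ)
    (ha : 0 < a.re) (hb : 0 < b.re) (hc : 0 < c.re) (hd : 0 < d.re)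
    (habcd : QuadCond a b c d)
    (x : Fin n → ℝ)
    (hcrit : ∀ j : Fin n,
      gfun a (x j) + gfun b (x j) + gfun c (x j) + gfun d (x j)
        + ∑ k ∈ Finset.univ.erase j,
            (Real.arctan (x j + x k) + Real.arctan (x j - x k))
      = Real.pi * (((j : ℕ) : ℝ) + 1)) :
    (∀ j : Fin n, 0 < x j) ∧ StrictMono x ∧
    ∀ j : Fin n,
      (I * a - (x j : ℂ)) * (I * b - (x j : ℂ)) * (I * c - (x j : ℂ))
          * (I * d - (x j : ℂ)) ≠ 0 ∧
      (∀ k : Fin n, k ≠ j →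
        (I - (x j : ℂ) - (x k : ℂ) ≠ 0 ∧ I - (x j : ℂ) + (x k : ℂ) ≠ 0)) ∧
      ((I * a + (x j : ℂ)) * (I * b + (x j : ℂ)) * (I * c + (x j : ℂ))
            * (I * d + (x j : ℂ)))
          / ((I * a - (x j : ℂ)) * (I * b - (x j : ℂ)) * (I * c - (x j : ℂ))
            * (I * d - (x j : ℂ)))
        * ∏ k ∈ Finset.univ.erase j,
            ((I + (x j : ℂ) + (x k : ℂ)) * (I + (x j : ℂ) - (x k : ℂ)))
              / ((I - (x j : ℂ) - (x k : ℂ)) * (I - (x j : ℂ) + (x k : ℂ)))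
      = 1 := by
  refine ⟨?_, ?_, ?_⟩
  · intro j
    by_contra! hj
    have hsum : ∑ k ∈ Finset.univ.erase j,
        (Real.arctan (x j + x k) + Real.arctan (x j - x k)) ≤ 0 := by
      refine Finset.sum_nonpos fun k _ => ?_
      have h : Real.arctan (x j + x k) ≤ Real.arctan (-(x j - x k)) :=
        Real.arctan_strictMono.monotone (by linarith)
      rw [Real.arctan_neg] at h
      linarith
    have hga := gfun_mono ha hj
    have hgb := gfun_mono hb hj
    have hgc := gfun_mono hc hj
    have hgd := gfun_mono hd hj
    rw [gfun_zero] at hga hgb hgc hgd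
    have hpos : 0 < Real.pi * (((j : ℕ) : ℝ) + 1) := by positivity
    linarith [hcrit j]
  · intro i j hij
    by_contra! hle
    have hfull (l : Fin n) := Finset.add_sum_erase Finset.univ
      (fun k => Real.arctan (x l + x k) + Real.arctan (x l - x k)) (Finset.mem_univ l)
    have hpair := Finset.sum_le_sum_of_subset_of_nonneg
      (f := fun k => (Real.arctan (x i + x k) + Real.arctan (x i - x k))
        - (Real.arctan (x j + x k) + Real.arctan (x j - x k)))
      (Finset.subset_univ {i, j}) fun k _ _ => by
        have h₁ : Real.arctan (x j + x k) ≤ Real.arctan (x i + x k) :=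
          Real.arctan_strictMono.monotone (by linarith)
        have h₂ : Real.arctan (x j - x k) ≤ Real.arctan (x i - x k) :=
          Real.arctan_strictMono.monotone (by linarith)
        linarith
    rw [Finset.sum_pair hij.ne, Finset.sum_sub_distrib] at hpair
    have hfi := hfull i
    have hfj := hfull j
    simp only [sub_self, Real.arctan_zero] at hpair hfi hfj
    have hnonneg : 0 ≤ Real.arctan (x i - x j) := Real.arctan_nonneg.mpr (by linarith)
    have hneg : Real.arctan (x j - x i) = -Real.arctan (x i - x j) := by
      rw [← Real.arctan_neg, neg_sub]
    have hga := gfun_mono ha hle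
    have hgb := gfun_mono hb hle
    have hgc := gfun_mono hc hle
    have hgd := gfun_mono hd hle
    have hlt : Real.pi * (((i : ℕ) : ℝ) + 1) < Real.pi * (((j : ℕ) : ℝ) + 1) := by
      have : ((i : ℕ) : ℝ) < ((j : ℕ) : ℝ) := by exact_mod_cast hij
      gcongr
    rw [add_comm (x j) (x i)] at hpair
    linarith [hcrit i, hcrit j]
  · intro j
    refine ⟨?_, ?_, ?_⟩
    · exact mul_ne_zero (mul_ne_zero (mul_ne_zero (I_mul_sub_ofReal_ne_zero ha _)
        (I_mul_sub_ofReal_ne_zero hb _)) (I_mul_sub_ofReal_ne_zero hc _))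
        (I_mul_sub_ofReal_ne_zero hd _)
    · intro k _
      constructor
      · simpa [sub_sub] using I_sub_ofReal_ne_zero (x j + x k)
      · simpa [sub_add] using I_sub_ofReal_ne_zero (x j - x k)
    · have hterm (k : Fin n) :
          ((I + (x j : ℂ) + (x k : ℂ)) * (I + (x j : ℂ) - (x k : ℂ)))
            / ((I - (x j : ℂ) - (x k : ℂ)) * (I - (x j : ℂ) + (x k : ℂ)))
          = Complex.exp (-(2 * I *
              ((Real.arctan (x j + x k) + Real.arctan (x j - x k) : ℝ) : ℂ))) := by
        rw [exp_neg_two_I_mul_ofReal_add, exp_neg_two_I_mul_arctan,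
          exp_neg_two_I_mul_arctan, div_mul_div_comm]
        push_cast
        simp only [add_assoc, add_sub_assoc, sub_sub, sub_add]
      rw [← habcd.exp_neg_two_I_mul_gfun ha hb hc hd, Finset.prod_congr rfl fun k _ => hterm k,
        ← Complex.exp_sum, Finset.sum_neg_distrib, ← Finset.mul_sum, ← Complex.ofReal_sum,
        ← Complex.exp_add, ← neg_add, ← mul_add, ← Complex.ofReal_add, hcrit j,
        Complex.exp_eq_one_iff]
      refine ⟨-((j : ℕ) + 1), ?_⟩
      push_cast
      ring
end

section
/- Let n ≥ 1, let a, b, c, d ∈ ℂ with positive real parts, let 0 < x₁ < x₂ < ⋯ < xₙ be real numbers, set p(x) = (x² − x₁²)(x² − x₂²)⋯(x² − xₙ²) ∈ ℂ[x] and A(x) = ((x + i·a)(x + i·b)(x + i·c)(x + i·d))/(2x(2x + i)). If A(x_j)·p(x_j + i) + A(−x_j)·p(x_j − i) = 0 for every j = 1,…,n, then p satisfies the Wilson difference equation: A(x)(p(x + i) − p(x)) + A(−x)(p(x − i) − p(x)) = −n(n + a + b + c + d − 1)·p(x) for every x ∈ ℂ with x ∉ {0, i/2, −i/2}. -/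
open Complex

open Polynomial in
/-- The even basis `∏_{j<k} (z² + (a+j)²)`, as a polynomial in the variable `z²`. -/
noncomputable def wilsonBasis (a : ℂ) (k : ℕ) : ℂ[X] :=
  ∏ j ∈ Finset.range k, (X + C ((a + j) ^ 2))

/-- The coefficient `A` of the Wilson difference operator. -/
noncomputable def wilsonCoeff (a b c d z : ℂ) : ℂ :=
  ((z + I * a) * (z + I * b) * (z + I * c) * (z + I * d)) / (2 * z * (2 * z + I))

/-- The Wilson difference operator applied to `z ↦ f (z²)`. -/
noncomputable def wilsonOp (a b c d : ℂ) (f : Polynomial ℂ) (z : ℂ) : ℂ :=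
  wilsonCoeff a b c d z * (f.eval ((z + I) ^ 2) - f.eval (z ^ 2))
    + wilsonCoeff a b c d (-z) * (f.eval ((z - I) ^ 2) - f.eval (z ^ 2))

lemma degree_add_lt_of_lt {f g : Polynomial ℂ} {m : WithBot ℕ} (hf : f.degree < m)
    (hg : g.degree < m) : (f + g).degree < m :=
  (Polynomial.degree_add_le f g).trans_lt (max_lt hf hg)

lemma wilsonBasis_succ (a : ℂ) (k : ℕ) : wilsonBasis a (k + 1) =
    wilsonBasis a k * (Polynomial.X + Polynomial.C ((a + k) ^ 2)) :=
  Finset.prod_range_succ _ _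

lemma wilsonBasis_monic (a : ℂ) (k : ℕ) : (wilsonBasis a k).Monic :=
  Polynomial.monic_prod_of_monic _ _ fun _ _ => Polynomial.monic_X_add_C _

lemma wilsonBasis_degree (a : ℂ) (k : ℕ) : (wilsonBasis a k).degree = k := by
  simp only [wilsonBasis, Polynomial.degree_prod, Polynomial.degree_X_add_C]
  simp

lemma wilsonBasis_eval_succ (a : ℂ) (k : ℕ) (z : ℂ) : (wilsonBasis a (k + 1)).eval (z ^ 2) =
    (wilsonBasis a k).eval (z ^ 2) * (z ^ 2 + (a + k) ^ 2) := by
  simp [wilsonBasis_succ]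

lemma wilsonBasis_eval_add_I (a : ℂ) (k : ℕ) (z : ℂ) :
    (a - I * z) * (wilsonBasis a (k + 1)).eval ((z + I) ^ 2) =
      (wilsonBasis a k).eval (z ^ 2) *
        ((a - 1 + I * z) * (a + k - I * z) * (a + k + 1 - I * z)) := by
  induction k with
  | zero =>
    simp only [wilsonBasis_eval_succ]
    simp only [wilsonBasis, Finset.range_zero, Finset.prod_empty, Polynomial.eval_one]
    push_cast
    linear_combination (a - I * z) * (z ^ 2 + 2 * I * z + 1 - 2 * I * z) * I_sq
  | succ k ih =>
    rw [wilsonBasis_eval_succ a (k + 1), ← mul_assoc, ih, wilsonBasis_eval_succ]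
    push_cast
    have h1 : (z + I) ^ 2 + (a + (k + 1)) ^ 2 = (a + k + I * z) * (a + k + 2 - I * z) := by
      linear_combination (z ^ 2 + 1) * I_sq
    have h2 : z ^ 2 + (a + k) ^ 2 = (a + k + I * z) * (a + k - I * z) := by
      linear_combination z ^ 2 * I_sq
    rw [h1, h2]
    ring

lemma wilsonBasis_eval_sub_I (a : ℂ) (k : ℕ) (z : ℂ) :
    (a + I * z) * (wilsonBasis a (k + 1)).eval ((z - I) ^ 2) =
      (wilsonBasis a k).eval (z ^ 2) *
        ((a - 1 - I * z) * (a + k + I * z) * (a + k + 1 + I * z)) := by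
  have h := wilsonBasis_eval_add_I a k (-z)
  rw [show (-z + I) ^ 2 = (z - I) ^ 2 by ring, neg_sq] at h
  linear_combination h

lemma wilsonCoeff_eq (a b c d z : ℂ) : wilsonCoeff a b c d z =
    ((a - I * z) * ((b - I * z) * (c - I * z) * (d - I * z))) /
      (2 * (I * z) * (1 - 2 * (I * z))) := by
  have h (t : ℂ) : z + I * t = I * (t - I * z) := by linear_combination z * I_sq
  unfold wilsonCoeff
  rw [h, h, h, h]
  congr 1
  · linear_combination
      (I ^ 2 - 1) * ((a - I * z) * ((b - I * z) * (c - I * z) * (d - I * z))) * I_sq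
  · linear_combination 4 * z ^ 2 * I_sq

lemma wilsonOp_add (a b c d : ℂ) (f g : Polynomial ℂ) (z : ℂ) :
    wilsonOp a b c d (f + g) z = wilsonOp a b c d f z + wilsonOp a b c d g z := by
  simp only [wilsonOp, Polynomial.eval_add]
  ring

lemma wilsonOp_smul (a b c d t : ℂ) (f : Polynomial ℂ) (z : ℂ) :
    wilsonOp a b c d (t • f) z = t * wilsonOp a b c d f z := by
  simp only [wilsonOp, Polynomial.eval_smul, smul_eq_mul]
  ring

lemma wilson_rational_identity (a b c d k : ℂ) {y P M F : ℂ} (hy : y ≠ 0) (hy1 : 1 - 2 * y ≠ 0)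
    (hy2 : 1 + 2 * y ≠ 0)
    (hP : (a - y) * P = F * ((a - 1 + y) * (a + k - y) * (a + k + 1 - y)))
    (hM : (a + y) * M = F * ((a - 1 - y) * (a + k + y) * (a + k + 1 + y))) :
    (a - y) * ((b - y) * (c - y) * (d - y)) / (2 * y * (1 - 2 * y)) *
        (P - F * ((a + k) ^ 2 - y ^ 2)) +
      (a + y) * ((b + y) * (c + y) * (d + y)) / (2 * -y * (1 - 2 * -y)) *
        (M - F * ((a + k) ^ 2 - y ^ 2)) =
      -(k + 1) * (k + 1 + a + b + c + d - 1) * (F * ((a + k) ^ 2 - y ^ 2)) +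
        (k + 1) * (a + b + k) * (a + c + k) * (a + d + k) * F := by
  have hD : 2 * y * (1 - 2 * y) ≠ 0 := mul_ne_zero (mul_ne_zero two_ne_zero hy) hy1
  have hE : 2 * y * (1 + 2 * y) ≠ 0 := mul_ne_zero (mul_ne_zero two_ne_zero hy) hy2
  rw [show 2 * -y * (1 - 2 * -y) = -(2 * y * (1 + 2 * y)) by ring, div_mul_eq_mul_div,
    div_mul_eq_mul_div, div_add_div _ _ hD (neg_ne_zero.2 hE),
    div_eq_iff (mul_ne_zero hD (neg_ne_zero.2 hE))]
  linear_combination -2 * y * (b - y) * (c - y) * (d - y) * (1 + 2 * y) * hP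
    + 2 * y * (b + y) * (c + y) * (d + y) * (1 - 2 * y) * hM

/-- The Wilson operator is bidiagonal in the basis `wilsonBasis a`. -/
lemma wilsonOp_wilsonBasis_succ (a b c d : ℂ) (k : ℕ) {z : ℂ} (h0 : z ≠ 0) (h1 : z ≠ I / 2)
    (h2 : z ≠ -(I / 2)) :
    wilsonOp a b c d (wilsonBasis a (k + 1)) z =
      -((k + 1 : ℕ) : ℂ) * ((k + 1 : ℕ) + a + b + c + d - 1) *
          (wilsonBasis a (k + 1)).eval (z ^ 2) +
        ((k + 1 : ℕ) : ℂ) * (a + b + k) * (a + c + k) * (a + d + k) *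
          (wilsonBasis a k).eval (z ^ 2) := by
  have hp := wilsonBasis_eval_add_I a k z
  have hm := wilsonBasis_eval_sub_I a k z
  have hy : I * z ≠ 0 := mul_ne_zero I_ne_zero h0
  have hy1 : 1 - 2 * (I * z) ≠ 0 := fun h => h2 (by
    linear_combination (I / 2) * h + z * I_sq)
  have hy2 : 1 + 2 * (I * z) ≠ 0 := fun h => h1 (by
    linear_combination (-I / 2) * h + z * I_sq)
  have hz : z ^ 2 + (a + k) ^ 2 = (a + k) ^ 2 - (I * z) ^ 2 := by
    linear_combination z ^ 2 * I_sq
  have hneg : I * -z = -(I * z) := by ring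
  rw [wilsonOp, wilsonCoeff_eq, wilsonCoeff_eq, wilsonBasis_eval_succ a k z, hz, hneg]
  push_cast
  rw [sub_neg_eq_add, sub_neg_eq_add, sub_neg_eq_add, sub_neg_eq_add]
  exact wilson_rational_identity a b c d k hy hy1 hy2 hp hm

lemma exists_wilsonOp_wilsonBasis (a b c d : ℂ) (k : ℕ) :
    ∃ r : Polynomial ℂ, r.degree < k ∧ ∀ z : ℂ, z ≠ 0 → z ≠ I / 2 → z ≠ -(I / 2) →
      wilsonOp a b c d (wilsonBasis a k) z =
        -(k : ℂ) * (k + a + b + c + d - 1) * (wilsonBasis a k).eval (z ^ 2) + r.eval (z ^ 2) := by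
  cases k with
  | zero => exact ⟨0, by simp, fun z _ _ _ => by simp [wilsonOp, wilsonBasis]⟩
  | succ k =>
    refine ⟨(((k + 1 : ℕ) : ℂ) * (a + b + k) * (a + c + k) * (a + d + k)) •
      wilsonBasis a k, ?_, fun z h0 h1 h2 => ?_⟩
    · refine (Polynomial.degree_smul_le _ _).trans_lt ?_
      rw [wilsonBasis_degree]
      exact_mod_cast k.lt_succ_self
    · rw [wilsonOp_wilsonBasis_succ a b c d k h0 h1 h2, Polynomial.eval_smul, smul_eq_mul]

/-- The Wilson operator does not raise the degree in `z²`. -/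
lemma exists_wilsonOp_of_degree_lt (a b c d : ℂ) (n : ℕ) (f : Polynomial ℂ) (hf : f.degree < n) :
    ∃ g : Polynomial ℂ, g.degree < n ∧ ∀ z : ℂ, z ≠ 0 → z ≠ I / 2 → z ≠ -(I / 2) →
      wilsonOp a b c d f z = g.eval (z ^ 2) := by
  induction n generalizing f with
  | zero =>
    have hf0 : f = 0 := by simpa using hf
    exact ⟨0, by simp, fun z _ _ _ => by simp [hf0, wilsonOp]⟩
  | succ n ih =>
    have hlt : ((n : ℕ) : WithBot ℕ) < ((n + 1 : ℕ) : WithBot ℕ) := by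
      exact_mod_cast n.lt_succ_self
    set t := f.coeff n
    have hdeg : (f - t • wilsonBasis a n).degree < n := by
      rw [Polynomial.degree_lt_iff_coeff_zero] at hf ⊢
      intro m hm
      have hlead : (wilsonBasis a n).coeff n = 1 := by
        have h := wilsonBasis_monic a n
        rwa [Polynomial.Monic, Polynomial.leadingCoeff,
          Polynomial.natDegree_eq_of_degree_eq_some (wilsonBasis_degree a n)] at h
      rw [Polynomial.coeff_sub, Polynomial.coeff_smul, smul_eq_mul]
      rcases hm.eq_or_lt with rfl | hm
      · rw [hlead, mul_one, sub_self]
      · rw [hf m hm, Polynomial.coeff_eq_zero_of_degree_lt, mul_zero, sub_zero]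
        rw [wilsonBasis_degree]
        exact_mod_cast hm
    obtain ⟨g, hg, hgz⟩ := ih _ hdeg
    obtain ⟨r, hr, hrz⟩ := exists_wilsonOp_wilsonBasis a b c d n
    refine ⟨g + ((t * (-(n : ℂ) * (n + a + b + c + d - 1))) • wilsonBasis a n
      + t • r), ?_, fun z h0 h1 h2 => ?_⟩
    · refine degree_add_lt_of_lt (hg.trans hlt)
        (degree_add_lt_of_lt ?_ ?_)
      · refine (Polynomial.degree_smul_le _ _).trans_lt ?_
        rwa [wilsonBasis_degree]
      · exact (Polynomial.degree_smul_le _ _).trans_lt (hr.trans hlt)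
    · have hsplit : f = (f - t • wilsonBasis a n) +
        t • wilsonBasis a n :=
        (sub_add_cancel _ _).symm
      rw [hsplit, wilsonOp_add, wilsonOp_smul, hgz z h0 h1 h2, hrz z h0 h1 h2]
      simp only [Polynomial.eval_add, Polynomial.eval_smul, smul_eq_mul]
      ring

/-- On monic polynomials of degree `n` in `z²`, the Wilson operator acts as multiplication by
`-n(n+a+b+c+d-1)` up to terms of lower degree. -/
lemma exists_wilsonOp_of_monic (a b c d : ℂ) (n : ℕ) (f : Polynomial ℂ) (hf : f.Monic)
    (hfn : f.degree = n) :
    ∃ g : Polynomial ℂ, g.degree < n ∧ ∀ z : ℂ, z ≠ 0 → z ≠ I / 2 → z ≠ -(I / 2) →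
      wilsonOp a b c d f z =
        -(n : ℂ) * (n + a + b + c + d - 1) * f.eval (z ^ 2) + g.eval (z ^ 2) := by
  have hdeg : (f - wilsonBasis a n).degree < n := by
    rw [← hfn]
    exact Polynomial.degree_sub_lt_left (hfn.trans (wilsonBasis_degree a n).symm) hf.ne_zero
      (hf.trans (wilsonBasis_monic a n).symm)
  obtain ⟨g, hg, hgz⟩ := exists_wilsonOp_of_degree_lt a b c d n _ hdeg
  obtain ⟨r, hr, hrz⟩ := exists_wilsonOp_wilsonBasis a b c d n
  refine ⟨g + (r + ((n : ℂ) * (n + a + b + c + d - 1)) • (f - wilsonBasis a n)),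
    ?_, fun z h0 h1 h2 => ?_⟩
  · exact degree_add_lt_of_lt hg (degree_add_lt_of_lt hr
      ((Polynomial.degree_smul_le _ _).trans_lt hdeg))
  · have hsplit : wilsonOp a b c d f z =
        wilsonOp a b c d ((f - wilsonBasis a n) + wilsonBasis a n) z := by
      rw [sub_add_cancel]
    rw [hsplit, wilsonOp_add, hgz z h0 h1 h2, hrz z h0 h1 h2]
    simp only [Polynomial.eval_add, Polynomial.eval_sub, Polynomial.eval_smul, smul_eq_mul]
    ring

theorem wilson_difference_equation
    (n : ℕ) (hn : 1 ≤ n) (a b c d : ℂ)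
    (ha : 0 < a.re) (hb : 0 < b.re) (hc : 0 < c.re) (hd : 0 < d.re)
    (x : Fin n → ℝ) (hpos : ∀ j : Fin n, 0 < x j) (hmono : StrictMono x)
    (A : ℂ → ℂ)
    (hA : A = fun z => ((z + I * a) * (z + I * b) * (z + I * c) * (z + I * d))
      / (2 * z * (2 * z + I)))
    (p : ℂ → ℂ) (hp : p = fun z => ∏ j : Fin n, (z ^ 2 - ((x j : ℂ)) ^ 2))
    (hnodes : ∀ j : Fin n,
      A (x j) * p ((x j : ℂ) + I) + A (-(x j : ℂ)) * p ((x j : ℂ) - I) = 0) :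
    ∀ z : ℂ, z ≠ 0 → z ≠ I / 2 → z ≠ -(I / 2) →
      A z * (p (z + I) - p z) + A (-z) * (p (z - I) - p z)
        = -(n : ℂ) * ((n : ℂ) + a + b + c + d - 1) * p z := by
  set f : Polynomial ℂ := ∏ j : Fin n, (Polynomial.X - Polynomial.C ((x j : ℂ) ^ 2)) with hf
  have hpf (z : ℂ) : p z = f.eval (z ^ 2) := by
    simp [hp, hf, Polynomial.eval_prod]
  have hAc : A = wilsonCoeff a b c d := hA
  have hop (z : ℂ) : A z * (p (z + I) - p z) + A (-z) * (p (z - I) - p z) =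
      wilsonOp a b c d f z := by
    rw [hAc, hpf, hpf, hpf, wilsonOp]
  obtain ⟨g, hg, hgz⟩ := exists_wilsonOp_of_monic a b c d n f
    (Polynomial.monic_prod_of_monic _ _ fun _ _ => Polynomial.monic_X_sub_C _)
    (by simp only [hf, Polynomial.degree_prod, Polynomial.degree_X_sub_C]; simp)
  have hroot (j : Fin n) : g.eval ((x j : ℂ) ^ 2) = 0 := by
    have hpj : p (x j) = 0 := by
      rw [hp]
      exact Finset.prod_eq_zero (Finset.mem_univ j) (sub_self _)
    have hre (w : ℂ) (hw : w.re = 0) : (x j : ℂ) ≠ w := fun h =>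
      (hpos j).ne' (by simpa [hw] using congrArg Complex.re h)
    have h := hgz (x j) (hre _ (by simp)) (hre _ (by simp)) (hre _ (by simp))
    rw [← hop, ← hpf, hpj, sub_zero, sub_zero, hnodes j, mul_zero, zero_add] at h
    exact h.symm
  have hinj : Function.Injective fun j : Fin n => (x j : ℂ) ^ 2 := fun i j hij => by
    have hij' : (x i : ℂ) ^ 2 = (x j : ℂ) ^ 2 := hij
    exact hmono.injective ((pow_left_inj₀ (hpos i).le (hpos j).le two_ne_zero).1 (by exact_mod_cast hij'))
  have hg0 : g = 0 := Polynomial.eq_zero_of_degree_lt_of_eval_index_eq_zero Finset.univ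
    (v := fun j : Fin n => (x j : ℂ) ^ 2) hinj.injOn (by simpa using hg) fun j _ => hroot j
  intro z h0 h1 h2
  rw [hop, hgz z h0 h1 h2, hg0, hpf, Polynomial.eval_zero, add_zero]
end

section
/- Let n ≥ 1, let a, b, c, d ∈ ℂ with positive real parts such that non-real parameters occur in complex-conjugate pairs, and let R > 0. Then for every x ∈ ℝⁿ with 0 < x_j ≤ R for all j, and for every y ∈ ℝⁿ, Σ_{1≤j≤n} (Σ_{ε∈{a,b,c,d}} Re(ε/(ε² + x_j²))) y_j² + Σ_{1≤j<k≤n} ((y_j + y_k)²/(1 + (x_j + x_k)²) + (y_j − y_k)²/(1 + (x_j − x_k)²)) ≥ (Σ_{ε∈{a,b,c,d}} Re(ε)/(Re(ε)² + (R + |Im(ε)|)²) + 2(n − 1)/(1 + 4R²))·(y₁² + ⋯ + yₙ²). -/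
/-- Partial fractions: `ε/(ε²+t²)` is the mean of `1/(ε+it)` and `1/(ε-it)`. -/
theorem re_div_sq_add_sq (e : ℂ) (he : 0 < e.re) (t : ℝ) :
    (e / (e ^ 2 + (t : ℂ) ^ 2)).re =
      (e.re / (e.re ^ 2 + (t + e.im) ^ 2) + e.re / (e.re ^ 2 + (t - e.im) ^ 2)) / 2 := by
  have h₁ : e + t * Complex.I ≠ 0 := fun h => by
    have := congrArg Complex.re h
    simp at this
    linarith
  have h₂ : e - t * Complex.I ≠ 0 := fun h => by
    have := congrArg Complex.re h
    simp at this
    linarith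
  have hprod : e ^ 2 + (t : ℂ) ^ 2 = (e + t * Complex.I) * (e - t * Complex.I) := by
    linear_combination (t : ℂ) ^ 2 * Complex.I_sq
  have hsplit : e / (e ^ 2 + (t : ℂ) ^ 2) =
      ((1 / 2 : ℝ) : ℂ) * ((e + t * Complex.I)⁻¹ + (e - t * Complex.I)⁻¹) := by
    rw [hprod]
    push_cast
    field_simp
    ring
  rw [hsplit, Complex.re_ofReal_mul, Complex.add_re, Complex.inv_re, Complex.inv_re,
    Complex.normSq_apply, Complex.normSq_apply]
  simp only [Complex.add_re, Complex.sub_re, Complex.add_im, Complex.sub_im, Complex.mul_re,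
    Complex.mul_im, Complex.ofReal_re, Complex.ofReal_im, Complex.I_re, Complex.I_im]
  ring_nf

theorem div_sq_add_sq_le {p u v : ℝ} (hp : 0 < p) (h : |u| ≤ v) :
    p / (p ^ 2 + v ^ 2) ≤ p / (p ^ 2 + u ^ 2) := by
  have : u ^ 2 ≤ v ^ 2 := sq_le_sq' (abs_le.mp h).1 (abs_le.mp h).2
  gcongr

theorem le_re_div_sq_add_sq (e : ℂ) (he : 0 < e.re) {t R : ℝ} (ht : |t| ≤ R) :
    e.re / (e.re ^ 2 + (R + |e.im|) ^ 2) ≤ (e / (e ^ 2 + (t : ℂ) ^ 2)).re := by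
  rw [re_div_sq_add_sq e he]
  have h₁ := div_sq_add_sq_le he ((abs_add_le t e.im).trans (add_le_add_left ht |e.im|))
  have h₂ := div_sq_add_sq_le he ((abs_sub t e.im).trans (add_le_add_left ht |e.im|))
  linarith

theorem sum_sum_ite_lt_add (n : ℕ) (f : Fin n → ℝ) :
    ∑ j : Fin n, ∑ k : Fin n, (if j < k then f j + f k else 0) =
      ((n : ℝ) - 1) * ∑ j : Fin n, f j := by
  have hsplit : ∑ j : Fin n, ∑ k : Fin n, (if j < k then f j + f k else 0) =
      (∑ j : Fin n, ∑ k : Fin n, if j < k then f j else 0) +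
        ∑ j : Fin n, ∑ k : Fin n, if k < j then f j else 0 := by
    rw [Finset.sum_comm (f := fun j k : Fin n => if k < j then f j else 0),
      ← Finset.sum_add_distrib]
    refine Finset.sum_congr rfl fun j _ => ?_
    rw [← Finset.sum_add_distrib]
    refine Finset.sum_congr rfl fun k _ => ?_
    split_ifs <;> simp
  rw [hsplit, ← Finset.sum_add_distrib, Finset.mul_sum]
  refine Finset.sum_congr rfl fun j _ => ?_
  have hoff : ∀ k : Fin n, ((if j < k then f j else 0) + if k < j then f j else 0) =
      f j - if j = k then f j else 0 := fun k => by
    rcases lt_trichotomy j k with h | h | h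
    · simp [h, h.not_gt, h.ne]
    · simp [h]
    · simp [h, h.not_gt, h.ne']
  rw [← Finset.sum_add_distrib, Finset.sum_congr rfl fun k _ => hoff k,
    Finset.sum_sub_distrib]
  simp
  ring

theorem pair_lower_bound {R s t : ℝ} (hs : |s| ≤ R) (ht : |t| ≤ R) (u v : ℝ) :
    2 / (1 + 4 * R ^ 2) * u ^ 2 + 2 / (1 + 4 * R ^ 2) * v ^ 2 ≤
      (u + v) ^ 2 / (1 + (s + t) ^ 2) + (u - v) ^ 2 / (1 + (s - t) ^ 2) := by
  have hadd : (s + t) ^ 2 ≤ 4 * R ^ 2 := by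
    rw [abs_le] at hs ht
    nlinarith
  have hsub : (s - t) ^ 2 ≤ 4 * R ^ 2 := by
    rw [abs_le] at hs ht
    nlinarith
  calc
    _ = (u + v) ^ 2 / (1 + 4 * R ^ 2) + (u - v) ^ 2 / (1 + 4 * R ^ 2) := by ring
    _ ≤ _ := by gcongr

/-- lower bound for the quadratic form of the Hessian of the Wilson Morse
function: for `0 < x_j ≤ R` and any `y`,
`Σ_j (Σ_{ε∈{a,b,c,d}} Re(ε/(ε²+x_j²))) y_j²
   + Σ_{j<k} ((y_j+y_k)²/(1+(x_j+x_k)²) + (y_j−y_k)²/(1+(x_j−x_k)²))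
 ≥ (Σ_{ε∈{a,b,c,d}} Re ε/(Re²ε+(R+|Im ε|)²) + 2(n−1)/(1+4R²)) (y₁²+⋯+yₙ²)`. -/
theorem wilson_hessian_lower_bound
    (n : ℕ) (hn : 1 ≤ n) (a b c d : ℂ)
    (ha : 0 < a.re) (hb : 0 < b.re) (hc : 0 < c.re) (hd : 0 < d.re)
    (habcd : QuadCond a b c d)
    (R : ℝ) (hR : 0 < R) (x : Fin n → ℝ) (hx : ∀ j : Fin n, 0 < x j ∧ x j ≤ R)
    (y : Fin n → ℝ) :
    (a.re / (a.re ^ 2 + (R + |a.im|) ^ 2) + b.re / (b.re ^ 2 + (R + |b.im|) ^ 2)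
        + c.re / (c.re ^ 2 + (R + |c.im|) ^ 2) + d.re / (d.re ^ 2 + (R + |d.im|) ^ 2)
        + 2 * ((n : ℝ) - 1) / (1 + 4 * R ^ 2)) * ∑ j : Fin n, (y j) ^ 2
      ≤ (∑ j : Fin n, ((a / (a ^ 2 + (x j : ℂ) ^ 2)).re
            + (b / (b ^ 2 + (x j : ℂ) ^ 2)).re
            + (c / (c ^ 2 + (x j : ℂ) ^ 2)).re
            + (d / (d ^ 2 + (x j : ℂ) ^ 2)).re) * (y j) ^ 2)
        + (∑ j : Fin n, ∑ k : Fin n,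
            if j < k then (y j + y k) ^ 2 / (1 + (x j + x k) ^ 2)
              + (y j - y k) ^ 2 / (1 + (x j - x k) ^ 2) else 0) := by
  have hxR : ∀ j, |x j| ≤ R := fun j => by rw [abs_of_pos (hx j).1]; exact (hx j).2
  rw [add_mul]
  refine add_le_add ?_ ?_
  · rw [Finset.mul_sum]
    refine Finset.sum_le_sum fun j _ => mul_le_mul_of_nonneg_right ?_ (sq_nonneg _)
    have h_a := le_re_div_sq_add_sq a ha (hxR j)
    have h_b := le_re_div_sq_add_sq b hb (hxR j)
    have h_c := le_re_div_sq_add_sq c hc (hxR j)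
    have h_d := le_re_div_sq_add_sq d hd (hxR j)
    linarith
  · calc
      _ = ((n : ℝ) - 1) * ∑ j : Fin n, 2 / (1 + 4 * R ^ 2) * y j ^ 2 := by
        rw [← Finset.mul_sum]
        ring
      _ = _ := (sum_sum_ite_lt_add n _).symm
      _ ≤ _ := by
        refine Finset.sum_le_sum fun j _ => Finset.sum_le_sum fun k _ => ?_
        split_ifs
        · exact pair_lower_bound (hxR j) (hxR k) (y j) (y k)
        · exact le_rfl
end
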